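/- arXiv:2310.13905 — 6 statements merged into one kernel-verified Lean document; each statement's English description precedes it below -/
import Mathlib

section
/- There exists a function u : ℤⁿ → ℝ such that: (i) Δu(x) = λ e^{u(x)}(e^{u(x)} − 1) + g(x) for all x ∈ ℤⁿ; (ii) u(x) → 0 as d(x) → ∞ (u is a topological solution); (iii) u ∈ l^p(ℤⁿ) for every 1 ≤ p ≤ ∞; (iv) u is maximal among all topological solutions: every f : ℤⁿ → ℝ satisfying (i) and (ii) satisfies f(x) ≤ u(x) for all x; (v) for every ε ∈ (0,1) there is a constant C(ε) > 0 such that |u(x)| ≤ C(ε) e^{−m(1−ε)d(x)} for all x ∈ ℤⁿ, where m = ln(1 + λ/(2n)). -/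
open Real

/-- Vertices of the lattice graph `ℤⁿ`. -/
abbrev Zn (n : ℕ) : Type := Fin n → ℤ

/-- The `i`-th standard basis vector. -/
def ee {n : ℕ} (i : Fin n) : Zn n := fun j => if j = i then 1 else 0

/-- `d(x) = d(x,0) = ∑ |xᵢ|`. -/
def dd {n : ℕ} (x : Zn n) : ℕ := ∑ i, (x i).natAbs

/-- The set of neighbors of `x`, i.e. `{y : d(x,y) = 1}`. -/
def nbrs {n : ℕ} (x : Zn n) : Finset (Zn n) :=
  (Finset.image (fun i : Fin n => x + ee i) Finset.univ) ∪
  (Finset.image (fun i : Fin n => x - ee i) Finset.univ)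

/-- The graph Laplacian `Δu(x) = ∑_{y ~ x} (u(y) - u(x))`. -/
def lap {n : ℕ} (u : Zn n → ℝ) (x : Zn n) : ℝ := ∑ y ∈ nbrs x, (u y - u x)

/-- The vertex boundary `δΩ` of a finite set `Ω ⊂ ℤⁿ`. -/
def bdry {n : ℕ} (Ω : Finset (Zn n)) : Finset (Zn n) := Ω.biUnion nbrs \ Ω

/-- `Ω̄ = Ω ∪ δΩ`. -/
def clos {n : ℕ} (Ω : Finset (Zn n)) : Finset (Zn n) := Ω ∪ bdry Ω
lemma lap_eq_sum {n : ℕ} (u : Zn n → ℝ) (x : Zn n) :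
    lap u x = ∑ i, (u (x + ee i) + u (x - ee i) - 2 * u x) := by
  have h1 : Function.Injective (fun i : Fin n => x + ee i) := by
    intro i j h
    have h2 := congrFun (add_left_cancel h) i
    by_contra hij
    simp [ee, hij] at h2
  have h2 : Function.Injective (fun i : Fin n => x - ee i) := by
    intro i j h
    have h2 := congrFun (sub_right_injective h) i
    by_contra hij
    simp [ee, hij] at h2
  have h3 : Disjoint (Finset.image (fun i : Fin n => x + ee i) Finset.univ)
      (Finset.image (fun i : Fin n => x - ee i) Finset.univ) := by
    rw [Finset.disjoint_left]
    intro y hy hy'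
    obtain ⟨i, -, rfl⟩ := Finset.mem_image.1 hy
    obtain ⟨j, -, h⟩ := Finset.mem_image.1 hy'
    have := congrFun h i
    simp only [Pi.sub_apply, Pi.add_apply, ee, if_true] at this
    split_ifs at this <;> omega
  rw [lap, nbrs, Finset.sum_union h3, Finset.sum_image h1.injOn, Finset.sum_image h2.injOn,
    ← Finset.sum_add_distrib]
  exact Finset.sum_congr rfl fun i _ => by ring

lemma exp_mul_exp_sub_one_sub_le {s t : ℝ} (hts : t ≤ s) (hs : s ≤ 0) :
    exp s * (exp s - 1) - exp t * (exp t - 1) ≤ s - t := by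
  have h1 : exp t = exp s * exp (t - s) := by rw [← exp_add]; ring_nf
  have h2 := add_one_le_exp (t - s)
  have h3 : exp s ≤ 1 := exp_le_one_iff.2 hs
  have h4 : exp t ≤ exp s := exp_le_exp.2 hts
  have h5 := exp_pos s
  have h6 : exp s - exp t ≤ s - t := by
    rw [h1]; nlinarith
  nlinarith

lemma sq_exp_sub_one_descent {t δ : ℝ} (ht : t ≤ 0) (hδ : δ ≤ 0) :
    (exp (t + δ) - 1) ^ 2 / 2 - (exp t - 1) ^ 2 / 2 ≤
      exp t * (exp t - 1) * δ + δ ^ 2 / 2 := by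
  rw [exp_add]
  have ha : exp t ≤ 1 := exp_le_one_iff.2 ht
  have hr : exp δ ≤ 1 := exp_le_one_iff.2 hδ
  have ha0 := exp_pos t
  have hr0 := exp_pos δ
  have h1 := add_one_le_exp δ
  generalize exp t = a at *
  generalize exp δ = r at *
  have hb : a * r ≤ 1 := by nlinarith
  have e1 : (1 - r) * (2 - a - a * r) ≤ -δ * (2 - a - a * r) :=
    mul_le_mul_of_nonneg_right (by linarith) (by linarith)
  have e2 : a * ((1 - r) * (2 - a - a * r)) ≤ a * (-δ * (2 - a - a * r)) :=
    mul_le_mul_of_nonneg_left e1 ha0.le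
  have e3 : a * a * (-δ * (1 - r)) ≤ 1 * (-δ * -δ) :=
    mul_le_mul (by nlinarith) (mul_le_mul_of_nonneg_left (by linarith) (by linarith))
      (mul_nonneg (by linarith) (by linarith)) zero_le_one
  nlinarith

/-- One damped Jacobi step for `Δu = λ eᵘ(eᵘ - 1) + g`, which is also a gradient descent step for
the energy of this equation. -/
noncomputable def jacobiStep {n : ℕ} (lam : ℝ) (g v : Zn n → ℝ) (x : Zn n) : ℝ :=
  v x + (lap v x - lam * (exp (v x) * (exp (v x) - 1)) - g x) / (2 * n + lam)

lemma jacobiStep_mono {n : ℕ} {lam : ℝ} (hlam : 0 < lam) {g v w : Zn n → ℝ}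
    (hvw : ∀ x, v x ≤ w x) (hw : ∀ x, w x ≤ 0) (x : Zn n) :
    jacobiStep lam g v x ≤ jacobiStep lam g w x := by
  have hK : 0 < 2 * (n : ℝ) + lam := by positivity
  have h1 := mul_le_mul_of_nonneg_left (exp_mul_exp_sub_one_sub_le (hvw x) (hw x)) hlam.le
  have h2 : lap v x + 2 * n * v x ≤ lap w x + 2 * n * w x := by
    have h (u : Zn n → ℝ) : lap u x + 2 * n * u x = ∑ i, (u (x + ee i) + u (x - ee i)) := by
      rw [lap_eq_sum, Finset.sum_sub_distrib]; simp; ring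
    rw [h, h]
    exact Finset.sum_le_sum fun i _ => add_le_add (hvw _) (hvw _)
  have h (u : Zn n → ℝ) : jacobiStep lam g u x = ((lap u x + 2 * n * u x) + lam * u x -
      lam * (exp (u x) * (exp (u x) - 1)) - g x) / (2 * n + lam) := by
    unfold jacobiStep; field_simp; ring
  rw [h, h]
  gcongr ?_ / _
  linarith

lemma jacobiStep_eq_self_iff {n : ℕ} {lam : ℝ} (hlam : 0 < lam) {g v : Zn n → ℝ} {x : Zn n} :
    jacobiStep lam g v x = v x ↔
      lap v x = lam * (exp (v x) * (exp (v x) - 1)) + g x := by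
  have hK : 2 * (n : ℝ) + lam ≠ 0 := by positivity
  rw [jacobiStep, add_eq_left, div_eq_zero_iff, or_iff_left hK]
  constructor <;> intro h <;> linarith

lemma eventually_comp_add {n : ℕ} {P : Zn n → Prop} (h : ∀ᶠ x in Filter.cofinite, P x)
    (e : Zn n) : ∀ᶠ x in Filter.cofinite, P (x + e) :=
  (add_left_injective e).tendsto_cofinite.eventually h

lemma summable_of_eventually_eq_zero {α : Type*} {F : α → ℝ}
    (h : ∀ᶠ x in Filter.cofinite, F x = 0) : Summable F :=
  summable_of_hasFiniteSupport (Filter.eventually_cofinite.1 h)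

lemma eventually_lap_eq_zero {n : ℕ} {v : Zn n → ℝ} (hv : ∀ᶠ x in Filter.cofinite, v x = 0) :
    ∀ᶠ x in Filter.cofinite, lap v x = 0 := by
  have h1 : ∀ᶠ x in Filter.cofinite, ∀ i : Fin n, v (x + ee i) = 0 :=
    Filter.eventually_all.2 fun i => eventually_comp_add hv _
  have h2 : ∀ᶠ x in Filter.cofinite, ∀ i : Fin n, v (x + -ee i) = 0 :=
    Filter.eventually_all.2 fun i => eventually_comp_add hv _
  filter_upwards [hv, h1, h2] with x a b c
  simp [lap_eq_sum, a, b, sub_eq_add_neg, c]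

lemma eventually_jacobiStep_eq_zero {n : ℕ} {lam : ℝ} {g v : Zn n → ℝ}
    (hg : ∀ᶠ x in Filter.cofinite, g x = 0) (hv : ∀ᶠ x in Filter.cofinite, v x = 0) :
    ∀ᶠ x in Filter.cofinite, jacobiStep lam g v x = 0 := by
  filter_upwards [hg, hv, eventually_lap_eq_zero hv] with x a b c
  simp [jacobiStep, a, b, c]

lemma summable_and_tsum_divergence {n : ℕ} {A : Fin n → Zn n → ℝ}
    (hA : ∀ i, ∀ᶠ x in Filter.cofinite, A i x = 0) :
    Summable (fun x => ∑ i, (A i (x + ee i) - A i x)) ∧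
      ∑' x, ∑ i, (A i (x + ee i) - A i x) = 0 := by
  have h1 i := summable_of_eventually_eq_zero (hA i)
  have h2 (i : Fin n) : Summable fun x => A i (x + ee i) :=
    summable_of_eventually_eq_zero (eventually_comp_add (hA i) _)
  refine ⟨summable_sum fun i _ => (h2 i).sub (h1 i), ?_⟩
  rw [Summable.tsum_finsetSum fun i _ => (h2 i).sub (h1 i)]
  refine Finset.sum_eq_zero fun i _ => ?_
  rw [(h2 i).tsum_sub (h1 i), sub_eq_zero]
  exact (Equiv.addRight (ee i)).tsum_eq (A i)

lemma tsum_lap_eq_zero {n : ℕ} {v : Zn n → ℝ} (hv : ∀ᶠ x in Filter.cofinite, v x = 0) :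
    ∑' x, lap v x = 0 := by
  have h := (summable_and_tsum_divergence (A := fun i x => v x - v (x - ee i)) fun i => by
    filter_upwards [hv, eventually_comp_add hv (-ee i)] with x a b
    simp [a, sub_eq_add_neg, b]).2
  rw [← h]
  refine tsum_congr fun x => ?_
  rw [lap_eq_sum]
  refine Finset.sum_congr rfl fun i _ => ?_
  rw [add_sub_cancel_right]
  ring

/-- The energy density whose Euler-Lagrange equation is `Δu = λ eᵘ(eᵘ - 1) + g`. -/
noncomputable def energyDensity {n : ℕ} (lam : ℝ) (g v : Zn n → ℝ) (x : Zn n) : ℝ :=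
  (∑ i, (v (x + ee i) - v x) ^ 2) / 2 + lam * ((exp (v x) - 1) ^ 2 / 2) + g x * v x

lemma eventually_gradient_sq_eq_zero {n : ℕ} {v : Zn n → ℝ}
    (hv : ∀ᶠ x in Filter.cofinite, v x = 0) :
    ∀ᶠ x in Filter.cofinite, ∑ i, (v (x + ee i) - v x) ^ 2 = 0 := by
  have h1 : ∀ᶠ x in Filter.cofinite, ∀ i : Fin n, v (x + ee i) = 0 :=
    Filter.eventually_all.2 fun i => eventually_comp_add hv _
  filter_upwards [hv, h1] with x a b
  simp [a, b]

lemma summable_energyDensity {n : ℕ} {lam : ℝ} {g v : Zn n → ℝ}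
    (hv : ∀ᶠ x in Filter.cofinite, v x = 0) : Summable (energyDensity lam g v) := by
  refine summable_of_eventually_eq_zero ?_
  filter_upwards [hv, eventually_gradient_sq_eq_zero hv] with x a b
  rw [energyDensity, b, a]
  simp

lemma tsum_energyDensity_jacobiStep_le {n : ℕ} {lam : ℝ} (hlam : 0 < lam) {g v : Zn n → ℝ}
    (hg : ∀ᶠ x in Filter.cofinite, g x = 0) (hv : ∀ᶠ x in Filter.cofinite, v x = 0)
    (hv0 : ∀ x, v x ≤ 0) (hstep : ∀ x, jacobiStep lam g v x ≤ v x) :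
    ∑' x, energyDensity lam g (jacobiStep lam g v) x ≤ ∑' x, energyDensity lam g v x := by
  have hw := eventually_jacobiStep_eq_zero (lam := lam) hg hv
  set w := jacobiStep lam g v with hw_def
  set δ : Zn n → ℝ := fun x => w x - v x with hδ_def
  set A : Fin n → Zn n → ℝ := fun i x => (v x - v (x - ee i)) * δ x + δ x ^ 2 with hA_def
  obtain ⟨hs, ht⟩ := summable_and_tsum_divergence (A := A) fun i => by
    filter_upwards [hv, hw] with x a b
    simp [hA_def, hδ_def, a, b]
  have key (x : Zn n) : energyDensity lam g w x - energyDensity lam g v x ≤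
      ∑ i, (A i (x + ee i) - A i x) := by
    have h1 := mul_le_mul_of_nonneg_left
      (sq_exp_sub_one_descent (hv0 x) (sub_nonpos.2 (hstep x))) hlam.le
    rw [add_sub_cancel] at h1
    have h2 : δ x * (2 * n + lam) = lap v x - lam * (exp (v x) * (exp (v x) - 1)) - g x := by
      have hK : 2 * (n : ℝ) + lam ≠ 0 := by positivity
      simp only [hδ_def, hw_def, jacobiStep]
      field_simp
      ring
    have h3 : (∑ i, (w (x + ee i) - w x) ^ 2) / 2 - (∑ i, (v (x + ee i) - v x) ^ 2) / 2 ≤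
        ∑ i, (A i (x + ee i) - A i x) - lap v x * δ x + 2 * n * δ x ^ 2 := by
      have e : 2 * (n : ℝ) * δ x ^ 2 = ∑ i : Fin n, 2 * δ x ^ 2 := by simp; ring
      rw [e, lap_eq_sum, Finset.sum_mul, ← Finset.sum_sub_distrib, ← Finset.sum_add_distrib,
        Finset.sum_div, Finset.sum_div, ← Finset.sum_sub_distrib]
      refine Finset.sum_le_sum fun i _ => ?_
      have hwv (y : Zn n) : w y = v y + δ y := by simp [hδ_def]
      simp only [hA_def, add_sub_cancel_right, hwv]
      nlinarith [sq_nonneg (δ (x + ee i) + δ x)]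
    unfold energyDensity
    have hd : w x - v x = δ x := rfl
    have hwx : g x * w x = g x * v x + g x * δ x := by rw [← hd]; ring
    rw [hd] at h1
    have h4 : δ x * (2 * n + lam) * δ x =
      (lap v x - lam * (exp (v x) * (exp (v x) - 1)) - g x) * δ x := by rw [h2]
    nlinarith [mul_nonneg hlam.le (sq_nonneg (δ x))]
  have h1 := summable_energyDensity (lam := lam) (g := g) hw
  have h2 := summable_energyDensity (lam := lam) (g := g) hv
  have h3 := (h1.sub h2).tsum_le_tsum key hs
  rw [h1.tsum_sub h2, ht] at h3
  linarith

lemma sum_comp_le_tsum {α β : Type*} {F : α → ℝ} (hF : ∀ x, 0 ≤ F x) (hs : Summable F)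
    (s : Finset β) {f : β → α} (hf : Function.Injective f) :
    ∑ b ∈ s, F (f b) ≤ ∑' x, F x := by
  have h := hs.sum_le_tsum (s.map ⟨f, hf⟩) fun x _ => hF x
  rwa [Finset.sum_map] at h

lemma sq_sub_le_mul_tsum_gradient_sq {n : ℕ} {v : Zn n → ℝ}
    (hv : ∀ᶠ x in Filter.cofinite, v x = 0) (i : Fin n) (x : Zn n) (k : ℕ) :
    (v (x + k • ee i) - v x) ^ 2 ≤ k * ∑' y, ∑ j, (v (y + ee j) - v y) ^ 2 := by
  have hinj : Function.Injective fun k : ℕ => x + k • ee i := by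
    intro a b h
    have := congrFun (add_left_cancel h) i
    simpa [ee] using this
  have h1 := Finset.sum_range_sub (fun k : ℕ => v (x + k • ee i)) k
  simp only [zero_smul, add_zero] at h1
  rw [← h1]
  refine sq_sum_le_card_mul_sum_sq.trans ?_
  rw [Finset.card_range]
  gcongr
  refine le_trans (Finset.sum_le_sum fun j _ => ?_)
    (sum_comp_le_tsum (fun y => Finset.sum_nonneg fun j _ => sq_nonneg (v (y + ee j) - v y))
      (summable_of_eventually_eq_zero (eventually_gradient_sq_eq_zero hv)) (Finset.range k) hinj)
  have e : x + (j + 1) • ee i = x + j • ee i + ee i := by rw [succ_nsmul, add_assoc]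
  rw [e]
  exact Finset.single_le_sum (f := fun l => (v (x + j • ee i + ee l) - v (x + j • ee i)) ^ 2)
    (fun l _ => sq_nonneg _) (Finset.mem_univ i)

/-- In dimension at least two, functions of nonpositive energy are bounded below by a constant
depending only on `λ` and the total mass of `g`. -/
lemma neg_le_of_tsum_energyDensity_nonpos {n : ℕ} (hn : 2 ≤ n) {lam C : ℝ} (hlam : 0 < lam)
    (hC : 0 < C) {g v : Zn n → ℝ} (hg0 : ∀ x, 0 ≤ g x)
    (hg : ∀ᶠ x in Filter.cofinite, g x = 0) (hgC : ∑' x, g x ≤ C)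
    (hv : ∀ᶠ x in Filter.cofinite, v x = 0)
    (henergy : ∑' x, energyDensity lam g v x ≤ 0) (x : Zn n) :
    -(2 + 32 * C * (256 * C ^ 2 / lam + 2)) ≤ v x := by
  set B := 256 * C ^ 2 / lam with hB
  have hB0 : 0 < B := by positivity
  have hpos : 0 < 32 * C * (B + 2) := by positivity
  by_cases hx : v x = 0
  · rw [hx]; linarith
  obtain ⟨x₀, hx₀, hmin⟩ := Set.exists_min_image {x | ¬ v x = 0} v
    (Filter.eventually_cofinite.1 hv) ⟨x, hx⟩
  refine le_trans ?_ (hmin x hx)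
  by_contra! hlt
  set T := -v x₀ with hT
  have hT2 : 2 < T := by linarith
  have hlow (y : Zn n) : -T ≤ v y := by
    by_cases hy : v y = 0
    · rw [hy]; linarith
    · simpa [hT] using hmin y hy
  set D := ∑' y, ∑ j, (v (y + ee j) - v y) ^ 2 with hD
  set P := ∑' y, (exp (v y) - 1) ^ 2 with hP
  have sD := summable_of_eventually_eq_zero (eventually_gradient_sq_eq_zero hv)
  have sP : Summable fun y => (exp (v y) - 1) ^ 2 := summable_of_eventually_eq_zero (by
    filter_upwards [hv] with y a
    simp [a])
  have sg := summable_of_eventually_eq_zero hg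
  have sgv : Summable fun y => g y * v y := summable_of_eventually_eq_zero (by
    filter_upwards [hv] with y a
    simp [a])
  have hD0 : 0 ≤ D := tsum_nonneg fun y => Finset.sum_nonneg fun j _ => sq_nonneg _
  have hP0 : 0 ≤ P := tsum_nonneg fun y => sq_nonneg _
  have hgv : -(T * C) ≤ ∑' y, g y * v y := by
    calc -(T * C) ≤ (∑' y, g y) * (-T) := by nlinarith
      _ = ∑' y, g y * (-T) := tsum_mul_right.symm
      _ ≤ _ := (sg.mul_right _).tsum_le_tsum
        (fun y => mul_le_mul_of_nonneg_left (hlow y) (hg0 y)) sgv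
  have hE : D / 2 + lam * (P / 2) + ∑' y, g y * v y ≤ 0 := by
    refine le_of_eq_of_le ?_ henergy
    unfold energyDensity
    rw [((sD.div_const 2).add ((sP.div_const 2).mul_left lam)).tsum_add sgv,
      (sD.div_const 2).tsum_add ((sP.div_const 2).mul_left lam), tsum_mul_left,
      tsum_div_const, tsum_div_const]
  have hDT : D ≤ 2 * C * T := by nlinarith [mul_nonneg hlam.le hP0]
  have hPT : lam * P ≤ 2 * C * T := by nlinarith
  set m := ⌊T / (32 * C)⌋₊ with hm
  have hm1 : 32 * C * m ≤ T := by
    have := Nat.floor_le (a := T / (32 * C)) (by positivity)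
    rw [le_div_iff₀ (by positivity)] at this
    linarith
  have hm2 : T < 32 * C * (m + 1) := by
    have := Nat.lt_floor_add_one (T / (32 * C))
    rw [div_lt_iff₀ (by positivity)] at this
    linarith
  let i₀ : Fin n := ⟨0, by omega⟩
  let i₁ : Fin n := ⟨1, by omega⟩
  have hne : i₀ ≠ i₁ := by simp [i₀, i₁]
  have hsquare (a b : ℕ) (ha : a < m) (hb : b < m) :
      v (x₀ + a • ee i₀ + b • ee i₁) ≤ -1 := by
    by_contra! hgt
    have h1 := sq_sub_le_mul_tsum_gradient_sq hv i₀ x₀ a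
    have h2 := sq_sub_le_mul_tsum_gradient_sq hv i₁ (x₀ + a • ee i₀) b
    rw [← hD] at h1 h2
    have ha' : (a : ℝ) * D ≤ m * D := by gcongr
    have hb' : (b : ℝ) * D ≤ m * D := by gcongr
    set p := v (x₀ + a • ee i₀ + b • ee i₁)
    set q := v (x₀ + a • ee i₀)
    have h3 : (p - v x₀) ^ 2 ≤ 4 * (m * D) := by nlinarith [sq_nonneg (p - q - (q - v x₀))]
    have h4 : T / 2 < p - v x₀ := by linarith
    have h5 : (m : ℝ) * D ≤ m * (2 * C * T) := by gcongr
    have h6 : 32 * C * m * T ≤ T * T := by gcongr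
    nlinarith
  have hcount : (m : ℝ) ^ 2 / 4 ≤ P := by
    have hinj : Function.Injective fun z : ℕ × ℕ => x₀ + z.1 • ee i₀ + z.2 • ee i₁ := by
      intro z z' h
      have e0 := congrFun h i₀
      have e1 := congrFun h i₁
      simp [ee, hne, hne.symm] at e0 e1
      exact Prod.ext e0 e1
    refine le_trans ?_ (sum_comp_le_tsum (fun y => sq_nonneg (exp (v y) - 1)) sP
      (Finset.range m ×ˢ Finset.range m) hinj)
    have : (m : ℝ) ^ 2 / 4 = ∑ z ∈ Finset.range m ×ˢ Finset.range m, (1 / 4 : ℝ) := by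
      simp; ring
    rw [this]
    refine Finset.sum_le_sum fun z hz => ?_
    rw [Finset.mem_product, Finset.mem_range, Finset.mem_range] at hz
    have h1 := exp_le_exp.2 (hsquare z.1 z.2 hz.1 hz.2)
    have h2 : exp (-1) ≤ 1 / 2 := by
      rw [exp_neg, one_div]
      exact inv_anti₀ two_pos (by linarith [add_one_le_exp (1 : ℝ)])
    nlinarith
  have h1 : (m : ℝ) ^ 2 ≤ B * (m + 1) := by
    rw [hB, div_mul_eq_mul_div, le_div_iff₀ hlam]
    have h2 : lam * (m ^ 2 / 4) ≤ lam * P := by gcongr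
    have h3 : C * T ≤ C * (32 * C * (m + 1)) := by gcongr
    nlinarith
  have h2 : (m : ℝ) ≤ B + 1 := by
    by_contra! h
    nlinarith
  have h3 : 32 * C * (m + 1 : ℝ) ≤ 32 * C * (B + 2) :=
    mul_le_mul_of_nonneg_left (by linarith) (by positivity)
  linarith

/-- The total mass of the nonlinearity along the Jacobi iteration is at most that of `g`. -/
lemma tsum_nonlinearity_le {n : ℕ} {lam : ℝ} (hlam : 0 < lam) {g v : Zn n → ℝ}
    (hg : ∀ᶠ x in Filter.cofinite, g x = 0) (hv : ∀ᶠ x in Filter.cofinite, v x = 0)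
    (hstep : ∀ x, jacobiStep lam g v x ≤ v x) :
    Summable (fun x => lam * (exp (v x) * (1 - exp (v x)))) ∧
      ∑' x, lam * (exp (v x) * (1 - exp (v x))) ≤ ∑' x, g x := by
  have s1 : Summable (fun x => lam * (exp (v x) * (1 - exp (v x)))) :=
    summable_of_eventually_eq_zero (by filter_upwards [hv] with y a; simp [a])
  have s2 := summable_of_eventually_eq_zero (eventually_lap_eq_zero hv)
  have s3 := summable_of_eventually_eq_zero hg
  refine ⟨s1, ?_⟩
  have h := (s2.add s1).tsum_le_tsum (fun x => ?_) s3
  · rwa [s2.tsum_add s1, tsum_lap_eq_zero hv, zero_add] at h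
  · have hK : 0 < 2 * (n : ℝ) + lam := by positivity
    have h1 := hstep x
    rw [jacobiStep, add_le_iff_nonpos_right, div_nonpos_iff] at h1
    rcases h1 with h1 | h1 <;> linarith [h1.1, h1.2]

lemma sum_abs_le_of_jacobiStep_le {n : ℕ} {lam T : ℝ} (hlam : 0 < lam) {g v : Zn n → ℝ}
    (hg : ∀ᶠ x in Filter.cofinite, g x = 0) (hv : ∀ᶠ x in Filter.cofinite, v x = 0)
    (hv0 : ∀ x, v x ≤ 0) (hT : ∀ x, -T ≤ v x) (hstep : ∀ x, jacobiStep lam g v x ≤ v x)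
    (s : Finset (Zn n)) :
    ∑ x ∈ s, |v x| ≤ exp (2 * T) / lam * ∑' x, g x := by
  obtain ⟨hs, hle⟩ := tsum_nonlinearity_le hlam hg hv hstep
  have key (x : Zn n) : |v x| ≤ exp (2 * T) / lam * (lam * (exp (v x) * (1 - exp (v x)))) := by
    have h1 : exp (v x) * exp (-v x) = 1 := by rw [← exp_add]; simp
    have h2 := add_one_le_exp (-v x)
    have h3 := exp_pos (v x)
    have h4 : exp (v x) * (-v x) ≤ 1 - exp (v x) := by nlinarith
    have h5 : 1 ≤ exp (2 * T) * (exp (v x) * exp (v x)) := by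
      rw [← exp_add, ← exp_add, one_le_exp_iff]; linarith [hT x]
    rw [abs_of_nonpos (hv0 x), ← mul_assoc, div_mul_cancel₀ _ hlam.ne']
    calc -v x = 1 * (-v x) := (one_mul _).symm
      _ ≤ exp (2 * T) * (exp (v x) * exp (v x)) * (-v x) :=
        mul_le_mul_of_nonneg_right h5 (by linarith [hv0 x])
      _ = exp (2 * T) * (exp (v x) * (exp (v x) * (-v x))) := by ring
      _ ≤ _ := by gcongr
  have hnn (x : Zn n) : 0 ≤ lam * (exp (v x) * (1 - exp (v x))) :=
    mul_nonneg hlam.le (mul_nonneg (exp_pos _).le (sub_nonneg.2 (exp_le_one_iff.2 (hv0 x))))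
  calc ∑ x ∈ s, |v x| ≤ ∑ x ∈ s, exp (2 * T) / lam * (lam * (exp (v x) * (1 - exp (v x)))) :=
        Finset.sum_le_sum fun x _ => key x
    _ = exp (2 * T) / lam * ∑ x ∈ s, lam * (exp (v x) * (1 - exp (v x))) := by
        rw [Finset.mul_sum]
    _ ≤ _ := by
      gcongr
      exact (hs.sum_le_tsum s fun x _ => hnn x).trans hle

lemma eventually_cofinite_of_dd {n : ℕ} {P : Zn n → Prop} {R : ℕ}
    (h : ∀ x, R ≤ dd x → P x) : ∀ᶠ x in Filter.cofinite, P x := by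
  rw [Filter.eventually_cofinite]
  refine (Set.finite_Icc (fun _ => -(R : ℤ)) (fun _ : Fin n => (R : ℤ))).subset fun x hx => ?_
  have hlt : dd x < R := not_le.1 fun h' => hx (h x h')
  have h1 (i : Fin n) : (x i).natAbs ≤ R :=
    (Finset.single_le_sum (f := fun i => (x i).natAbs) (fun _ _ => Nat.zero_le _)
      (Finset.mem_univ i)).trans hlt.le
  exact ⟨fun i => by have := h1 i; dsimp only; omega, fun i => by have := h1 i; dsimp only; omega⟩

lemma exists_dd_of_eventually_cofinite {n : ℕ} {P : Zn n → Prop}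
    (h : ∀ᶠ x in Filter.cofinite, P x) : ∃ R : ℕ, ∀ x, R ≤ dd x → P x := by
  obtain ⟨R, hR⟩ := ((Filter.eventually_cofinite.1 h).image dd).bddAbove
  refine ⟨R + 1, fun x hx => ?_⟩
  by_contra hP
  have := hR ⟨x, hP, rfl⟩
  omega

lemma tendsto_cofinite_iff_dd {n : ℕ} {f : Zn n → ℝ} :
    Filter.Tendsto f Filter.cofinite (nhds 0) ↔
      ∀ ε : ℝ, 0 < ε → ∃ R : ℕ, ∀ x : Zn n, R ≤ dd x → |f x| < ε := by
  simp only [Metric.tendsto_nhds, dist_zero_right, norm_eq_abs]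
  exact ⟨fun h ε hε => exists_dd_of_eventually_cofinite (h ε hε),
    fun h ε hε => (h ε hε).elim fun R hR => eventually_cofinite_of_dd hR⟩

lemma exists_isMax_of_tendsto_zero {α : Type*} {f : α → ℝ}
    (hf : Filter.Tendsto f Filter.cofinite (nhds 0)) {a : α} (ha : 0 < f a) :
    ∃ b, 0 < f b ∧ ∀ x, f x ≤ f b := by
  have hfin : {x | ¬ f x < f a}.Finite :=
    Filter.eventually_cofinite.1 (hf.eventually (gt_mem_nhds ha))
  obtain ⟨b, -, hb⟩ := Set.exists_max_image _ f hfin ⟨a, lt_irrefl (f a)⟩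
  have hab := hb a (lt_irrefl (f a))
  refine ⟨b, ha.trans_le hab, fun x => ?_⟩
  by_cases hx : f x < f a
  · exact hx.le.trans hab
  · exact hb x hx

lemma lap_nonpos_of_isMax {n : ℕ} {f : Zn n → ℝ} {b : Zn n} (hb : ∀ x, f x ≤ f b) :
    lap f b ≤ 0 :=
  Finset.sum_nonpos fun y _ => sub_nonpos.2 (hb y)

lemma topological_solution_nonpos {n : ℕ} {lam : ℝ} (hlam : 0 < lam) {g f : Zn n → ℝ}
    (hg0 : ∀ x, 0 ≤ g x)
    (hf : ∀ x, lap f x = lam * (exp (f x) * (exp (f x) - 1)) + g x)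
    (hf0 : Filter.Tendsto f Filter.cofinite (nhds 0)) (x : Zn n) : f x ≤ 0 := by
  by_contra! hx
  obtain ⟨b, hb, hmax⟩ := exists_isMax_of_tendsto_zero hf0 hx
  have h1 := lap_nonpos_of_isMax hmax
  rw [hf b] at h1
  have h2 : 0 < lam * (exp (f b) * (exp (f b) - 1)) :=
    mul_pos hlam (mul_pos (exp_pos _) (sub_pos.2 (one_lt_exp_iff.2 hb)))
  linarith [hg0 b]

lemma dd_le_dd_add {n : ℕ} (x : Zn n) (i : Fin n) {e : Zn n} (he : e = ee i ∨ e = -ee i) :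
    dd x ≤ dd (x + e) + 1 := by
  have h : (1 : ℕ) = ∑ j, if j = i then 1 else 0 := by simp
  unfold dd
  conv_rhs => rw [h]
  rw [← Finset.sum_add_distrib]
  refine Finset.sum_le_sum fun j _ => ?_
  rcases he with rfl | rfl <;> simp only [Pi.add_apply, Pi.neg_apply, ee] <;> split_ifs <;> omega

lemma lap_exp_neg_dd_le {n : ℕ} {α : ℝ} (hα : 0 ≤ α) (x : Zn n) :
    lap (fun y => exp (-α * dd y)) x ≤ 2 * n * (exp α - 1) * exp (-α * dd x) := by
  have h (e : Zn n) (i : Fin n) (he : e = ee i ∨ e = -ee i) :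
      exp (-α * dd (x + e)) ≤ exp α * exp (-α * dd x) := by
    rw [← exp_add, exp_le_exp]
    have : (dd x : ℝ) ≤ dd (x + e) + 1 := by exact_mod_cast dd_le_dd_add x i he
    nlinarith
  rw [lap_eq_sum]
  calc _ ≤ ∑ i : Fin n, 2 * (exp α - 1) * exp (-α * dd x) := by
        refine Finset.sum_le_sum fun i _ => ?_
        have h1 := h _ i (Or.inl rfl)
        have h2 := h _ i (Or.inr rfl)
        rw [← sub_eq_add_neg] at h2
        linarith
    _ = _ := by simp; ring

/-- Exponential decay by comparison with `exp (-α d(x))`. -/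
lemma exp_decay_of_tendsto_zero {n : ℕ} {lam α : ℝ} (hα : 0 < α)
    (hαlam : 2 * n * (exp α - 1) < lam) {g u : Zn n → ℝ}
    (hg : ∀ᶠ x in Filter.cofinite, g x = 0)
    (hu : ∀ x, lap u x = lam * (exp (u x) * (exp (u x) - 1)) + g x)
    (hu0 : Filter.Tendsto u Filter.cofinite (nhds 0)) (hneg : ∀ x, u x ≤ 0) :
    ∃ C : ℝ, 0 < C ∧ ∀ x, |u x| ≤ C * exp (-α * dd x) := by
  set κ := 2 * n * (exp α - 1) with hκ
  have hκ0 : 0 ≤ κ := mul_nonneg (by positivity) (sub_nonneg.2 (one_le_exp hα.le))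
  have hlam : 0 < lam := hκ0.trans_lt hαlam
  have hev : ∀ᶠ x in Filter.cofinite, g x = 0 ∧ κ < lam * exp (2 * u x) := by
    refine hg.and ?_
    have h1 : Filter.Tendsto (fun x => lam * exp (2 * u x)) Filter.cofinite (nhds lam) := by
      have : Filter.Tendsto (fun x => lam * exp (2 * u x)) Filter.cofinite
          (nhds (lam * exp (2 * 0))) :=
        ((continuous_exp.tendsto _).comp (hu0.const_mul 2)).const_mul lam
      simpa using this
    exact h1.eventually (lt_mem_nhds hαlam)
  have hfin := Filter.eventually_cofinite.1 hev
  obtain ⟨A, hA⟩ := (hfin.image fun x => -u x * exp (α * dd x)).bddAbove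
  set C := max A 1 with hC
  have hC0 : 0 < C := lt_max_of_lt_right one_pos
  refine ⟨C, hC0, fun x => ?_⟩
  rw [abs_of_nonpos (hneg x)]
  set ψ : Zn n → ℝ := fun y => exp (-α * dd y) with hψ
  by_contra! hx
  have hψ0 : Filter.Tendsto ψ Filter.cofinite (nhds 0) := by
    rw [tendsto_cofinite_iff_dd]
    intro ε hε
    have ht : Filter.Tendsto (fun k : ℕ => exp (-α * k)) Filter.atTop (nhds 0) :=
      tendsto_exp_atBot.comp
        ((tendsto_natCast_atTop_atTop).const_mul_atTop_of_neg (neg_lt_zero.2 hα))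
    obtain ⟨R, hR⟩ := Filter.eventually_atTop.1 (ht.eventually (gt_mem_nhds hε))
    exact ⟨R, fun y hy => by rw [hψ, abs_of_pos (exp_pos _)]; exact hR _ hy⟩
  have hF0 : Filter.Tendsto (fun y => -u y - C * ψ y) Filter.cofinite (nhds 0) := by
    simpa using hu0.neg.sub (hψ0.const_mul C)
  obtain ⟨b, hb, hmax⟩ := exists_isMax_of_tendsto_zero hF0 (a := x) (sub_pos.2 hx)
  have hgood : g b = 0 ∧ κ < lam * exp (2 * u b) := by
    by_contra hbad
    have h1 : -u b * exp (α * dd b) ≤ C := (hA ⟨b, hbad, rfl⟩).trans (le_max_left _ _)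
    have h2 : -u b ≤ C * ψ b := by
      have h3 : exp (α * dd b) * ψ b = 1 := by rw [hψ, ← exp_add]; simp
      have h4 : 0 < ψ b := exp_pos _
      calc -u b = -u b * exp (α * dd b) * ψ b := by rw [mul_assoc, h3, mul_one]
        _ ≤ _ := by gcongr
    linarith
  have hlap := lap_nonpos_of_isMax hmax
  have hlin : lap (fun y => -u y - C * ψ y) b = -lap u b - C * lap ψ b := by
    simp only [lap, Finset.mul_sum, ← Finset.sum_neg_distrib, ← Finset.sum_sub_distrib]
    exact Finset.sum_congr rfl fun y _ => by ring
  rw [hlin, hu b, hgood.1] at hlap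
  have h1 : lap ψ b ≤ κ * ψ b := lap_exp_neg_dd_le hα.le b
  have h2 : C * lap ψ b ≤ C * (κ * ψ b) := by gcongr
  have hψb : 0 < C * ψ b := mul_pos hC0 (exp_pos _)
  have h3 : 0 < -u b := by linarith
  have h4 : lam * exp (2 * u b) * (-u b) ≤ -(lam * (exp (u b) * (exp (u b) - 1))) := by
    have e1 : exp (2 * u b) = exp (u b) * exp (u b) := by rw [← exp_add]; ring_nf
    have e2 := add_one_le_exp (-u b)
    have e3 : exp (u b) * exp (-u b) = 1 := by rw [← exp_add]; simp
    have e4 := exp_pos (u b)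
    have e5 : exp (u b) * (-u b) ≤ 1 - exp (u b) := by nlinarith
    have e6 : lam * exp (u b) * (exp (u b) * (-u b)) ≤ lam * exp (u b) * (1 - exp (u b)) := by
      gcongr
    rw [e1]
    linarith
  have h5 : κ * (-u b) < lam * exp (2 * u b) * (-u b) := by
    gcongr
    exact hgood.2
  have h6 : κ * (C * ψ b) ≤ κ * (-u b) := by gcongr; linarith
  linarith

lemma tendsto_jacobiStep {n : ℕ} {lam : ℝ} {g u : Zn n → ℝ} {v : ℕ → Zn n → ℝ}
    (h : ∀ x, Filter.Tendsto (fun k => v k x) Filter.atTop (nhds (u x))) (x : Zn n) :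
    Filter.Tendsto (fun k => jacobiStep lam g (v k) x) Filter.atTop
      (nhds (jacobiStep lam g u x)) := by
  have hl : Filter.Tendsto (fun k => lap (v k) x) Filter.atTop (nhds (lap u x)) :=
    tendsto_finsetSum _ fun y _ => (h y).sub (h x)
  have he : Filter.Tendsto (fun k => exp (v k x)) Filter.atTop (nhds (exp (u x))) :=
    (continuous_exp.tendsto _).comp (h x)
  exact (h x).add (((hl.sub ((he.mul (he.sub_const 1)).const_mul lam)).sub_const (g x)).div_const _)

/-- The maximal topological solution is the limit of the Jacobi iteration started at `0`. -/
lemma exists_maximal_summable_solution {n : ℕ} (hn : 2 ≤ n) {lam : ℝ} (hlam : 0 < lam)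
    {g : Zn n → ℝ} (hg0 : ∀ x, 0 ≤ g x) (hg : ∀ᶠ x in Filter.cofinite, g x = 0) :
    ∃ u : Zn n → ℝ, (∀ x, u x ≤ 0) ∧
      (∀ x, lap u x = lam * (exp (u x) * (exp (u x) - 1)) + g x) ∧
      Summable (fun x => |u x|) ∧
      ∀ f : Zn n → ℝ, (∀ x, lap f x = lam * (exp (f x) * (exp (f x) - 1)) + g x) →
        Filter.Tendsto f Filter.cofinite (nhds 0) → ∀ x, f x ≤ u x := by
  have hK : 0 < 2 * (n : ℝ) + lam := by positivity
  set v : ℕ → Zn n → ℝ := fun k => (jacobiStep lam g)^[k] (fun _ => 0) with hv_def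
  have hsucc (k : ℕ) : v (k + 1) = jacobiStep lam g (v k) :=
    Function.iterate_succ_apply' _ _ _
  have hfin (k : ℕ) : ∀ᶠ x in Filter.cofinite, v k x = 0 := by
    induction k with
    | zero => exact Filter.Eventually.of_forall fun _ => rfl
    | succ k ih => rw [hsucc]; exact eventually_jacobiStep_eq_zero hg ih
  have hmono (k : ℕ) : (∀ x, v k x ≤ 0) ∧ ∀ x, jacobiStep lam g (v k) x ≤ v k x := by
    induction k with
    | zero =>
      refine ⟨fun _ => le_rfl, fun x => ?_⟩
      have : jacobiStep lam g (v 0) x = -g x / (2 * n + lam) := by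
        simp [hv_def, jacobiStep, lap]
      rw [this]
      exact div_nonpos_of_nonpos_of_nonneg (neg_nonpos.2 (hg0 x)) hK.le
    | succ k ih =>
      rw [hsucc]
      exact ⟨fun x => (ih.2 x).trans (ih.1 x), fun x => jacobiStep_mono hlam ih.2 ih.1 x⟩
  have henergy (k : ℕ) : ∑' x, energyDensity lam g (v k) x ≤ 0 := by
    induction k with
    | zero => simp [hv_def, energyDensity]
    | succ k ih =>
      rw [hsucc]
      exact (tsum_energyDensity_jacobiStep_le hlam hg (hfin k) (hmono k).1 (hmono k).2).trans ih
  have hC : 0 < ∑' x, g x + 1 := add_pos_of_nonneg_of_pos (tsum_nonneg hg0) one_pos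
  obtain ⟨T, hT⟩ : ∃ T : ℝ, ∀ k x, -T ≤ v k x :=
    ⟨_, fun k => neg_le_of_tsum_energyDensity_nonpos hn hlam hC hg0 hg (by linarith) (hfin k)
      (henergy k)⟩
  have hanti (x : Zn n) : Antitone fun k => v k x :=
    antitone_nat_of_succ_le fun k => by rw [hsucc]; exact (hmono k).2 x
  set u : Zn n → ℝ := fun x => ⨅ k, v k x
  have hlim (x : Zn n) : Filter.Tendsto (fun k => v k x) Filter.atTop (nhds (u x)) :=
    tendsto_atTop_ciInf (hanti x) ⟨-T, by rintro _ ⟨k, rfl⟩; exact hT k x⟩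
  refine ⟨u, fun x => le_of_tendsto' (hlim x) fun k => (hmono k).1 x, fun x => ?_, ?_,
    fun f hf hf0 x => ?_⟩
  · rw [← jacobiStep_eq_self_iff hlam]
    refine tendsto_nhds_unique (tendsto_jacobiStep hlim x) ?_
    have := (hlim x).comp (Filter.tendsto_add_atTop_nat 1)
    refine this.congr fun k => ?_
    simp only [Function.comp, hsucc]
  · refine summable_of_sum_le (c := exp (2 * T) / lam * ∑' x, g x) (fun x => abs_nonneg _)
      fun s => ?_
    exact le_of_tendsto' (tendsto_finsetSum s fun x _ => (hlim x).abs) fun k =>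
      sum_abs_le_of_jacobiStep_le hlam hg (hfin k) (hmono k).1 (hT k) (hmono k).2 s
  · have hfv (k : ℕ) : ∀ x, f x ≤ v k x := by
      induction k with
      | zero => exact topological_solution_nonpos hlam hg0 hf hf0
      | succ k ih =>
        intro y
        rw [hsucc, ← (jacobiStep_eq_self_iff hlam).2 (hf y)]
        exact jacobiStep_mono hlam ih (hmono k).1 y
    exact ge_of_tendsto' (hlim x) fun k => hfv k x

lemma summable_abs_rpow_of_summable_abs {α : Type*} {u : α → ℝ} (h : Summable fun x => |u x|)
    {q : ℝ} (hq : 1 ≤ q) : Summable fun x => |u x| ^ q := by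
  refine Summable.of_norm_bounded_eventually h ?_
  filter_upwards [h.tendsto_cofinite_zero.eventually (gt_mem_nhds one_pos)] with x hx
  rw [norm_eq_abs, abs_of_nonneg (rpow_nonneg (abs_nonneg _) _)]
  exact (rpow_le_rpow_of_exponent_ge' (abs_nonneg _) hx.le zero_le_one hq).trans_eq (rpow_one _)


/-- Existence of a maximal topological solution to the Chern–Simons equation on `ℤⁿ`. -/
theorem stmt0 (n : ℕ) (hn : 2 ≤ n) (lam : ℝ) (hlam : 0 < lam)
    (M : ℕ) (hM : 1 ≤ M) (nn : Fin M → ℕ) (hnn : ∀ j, 0 < nn j)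
    (p : Fin M → Zn n) (hp : Function.Injective p)
    (g : Zn n → ℝ)
    (hg : ∀ x, g x = ∑ j, if x = p j then 4 * Real.pi * (nn j : ℝ) else 0) :
    ∃ u : Zn n → ℝ,
      -- (i) u solves the Chern–Simons equation
      (∀ x, lap u x = lam * (Real.exp (u x) * (Real.exp (u x) - 1)) + g x) ∧
      -- (ii) u(x) → 0 as d(x) → ∞
      (∀ ε : ℝ, 0 < ε → ∃ R : ℕ, ∀ x : Zn n, R ≤ dd x → |u x| < ε) ∧
      -- (iii) u ∈ l^p for every 1 ≤ p < ∞ and for p = ∞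
      (∀ q : ℝ, 1 ≤ q → Summable (fun x : Zn n => |u x| ^ q)) ∧
      (∃ B : ℝ, ∀ x : Zn n, |u x| ≤ B) ∧
      -- (iv) u is maximal among all topological solutions
      (∀ f : Zn n → ℝ,
        (∀ x, lap f x = lam * (Real.exp (f x) * (Real.exp (f x) - 1)) + g x) →
        (∀ ε : ℝ, 0 < ε → ∃ R : ℕ, ∀ x : Zn n, R ≤ dd x → |f x| < ε) →
        ∀ x, f x ≤ u x) ∧
      -- (v) the decay estimate with m = ln(1 + λ/(2n))
      (∀ ε : ℝ, 0 < ε → ε < 1 → ∃ C : ℝ, 0 < C ∧ ∀ x : Zn n,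
        |u x| ≤ C * Real.exp (-(Real.log (1 + lam / (2 * n)) * (1 - ε)) * (dd x : ℝ))) := by
  have hg0 (x : Zn n) : 0 ≤ g x := by
    rw [hg]
    exact Finset.sum_nonneg fun j _ => by split_ifs <;> positivity
  have hgfin : ∀ᶠ x in Filter.cofinite, g x = 0 := by
    rw [Filter.eventually_cofinite]
    refine (Set.finite_range p).subset fun x hx => ?_
    by_contra hxp
    refine hx ?_
    rw [hg]
    exact Finset.sum_eq_zero fun j _ => if_neg fun h => hxp ⟨j, h.symm⟩
  obtain ⟨u, hneg, hu, hsum, hmax⟩ := exists_maximal_summable_solution hn hlam hg0 hgfin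
  have hu0 : Filter.Tendsto u Filter.cofinite (nhds 0) :=
    (tendsto_zero_iff_abs_tendsto_zero _).2 hsum.tendsto_cofinite_zero
  refine ⟨u, hu, tendsto_cofinite_iff_dd.1 hu0,
    fun q hq => summable_abs_rpow_of_summable_abs hsum hq,
    ⟨_, fun x => hsum.le_tsum x fun _ _ => abs_nonneg _⟩,
    fun f hf hf0 => hmax f hf (tendsto_cofinite_iff_dd.2 hf0), fun ε hε hε1 => ?_⟩
  have hn0 : 0 < 2 * (n : ℝ) := by
    have : 0 < n := by omega
    positivity
  have hquot : 0 < lam / (2 * n) := div_pos hlam hn0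
  have hlog : 0 < Real.log (1 + lam / (2 * n)) := Real.log_pos (by linarith)
  refine exp_decay_of_tendsto_zero (mul_pos hlog (sub_pos.2 hε1)) ?_ hgfin hu hu0 hneg
  have hexp : Real.exp (Real.log (1 + lam / (2 * n)) * (1 - ε)) < 1 + lam / (2 * n) := by
    rw [← Real.lt_log_iff_exp_lt (by linarith)]
    nlinarith
  calc 2 * (n : ℝ) * (Real.exp (Real.log (1 + lam / (2 * n)) * (1 - ε)) - 1)
      < 2 * n * (lam / (2 * n)) := by gcongr; linarith
    _ = lam := mul_div_cancel₀ _ hn0.ne'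
end

section
/- There exists a unique function u' : ℤⁿ → ℝ such that Δu'(x) = λ(e^{u'(x)} − 1) + g(x) for all x ∈ ℤⁿ and u'(x) → 0 as d(x) → ∞. Moreover u' ≤ 0 on ℤⁿ, u' ∈ l^p(ℤⁿ) for every 1 ≤ p ≤ ∞, every topological solution u of the Chern–Simons equation Δu = λ e^u(e^u − 1) + g with u(x) → 0 as d(x) → ∞ satisfies u ≤ u' on ℤⁿ, and for every ε ∈ (0,1) there is C(ε) > 0 with |u'(x)| ≤ C(ε) e^{−m(1−ε)d(x)} for all x, where m = ln(1 + λ/(2n)). -/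
open Real

section Lattice

variable {n : ℕ}

theorem mem_nbrs {x y : Zn n} : y ∈ nbrs x ↔ ∃ i, y = x + ee i ∨ y = x - ee i := by
  simp only [nbrs, Finset.mem_union, Finset.mem_image, Finset.mem_univ, true_and, eq_comm (a := y),
    exists_or]

theorem nbrs_symm {x y : Zn n} (h : y ∈ nbrs x) : x ∈ nbrs y := by
  obtain ⟨i, rfl | rfl⟩ := mem_nbrs.1 h
  · exact mem_nbrs.2 ⟨i, Or.inr (by simp)⟩
  · exact mem_nbrs.2 ⟨i, Or.inl (by simp)⟩

theorem mem_nbrs_comm {x y : Zn n} : y ∈ nbrs x ↔ x ∈ nbrs y := ⟨nbrs_symm, nbrs_symm⟩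

theorem card_nbrs_le (x : Zn n) : ((nbrs x).card : ℝ) ≤ 2 * n := by
  have h1 : (Finset.image (fun i : Fin n => x + ee i) Finset.univ).card ≤ n :=
    Finset.card_image_le.trans (by simp)
  have h2 : (Finset.image (fun i : Fin n => x - ee i) Finset.univ).card ≤ n :=
    Finset.card_image_le.trans (by simp)
  have h : (nbrs x).card ≤ 2 * n := (Finset.card_union_le _ _).trans (by omega)
  exact_mod_cast h

theorem dd_ee (i : Fin n) : dd (ee i) = 1 := by
  unfold dd ee
  rw [Finset.sum_eq_single i] <;> simp +contextual

theorem dd_add_le (x y : Zn n) : dd (x + y) ≤ dd x + dd y := by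
  unfold dd
  rw [← Finset.sum_add_distrib]
  exact Finset.sum_le_sum fun i _ => Int.natAbs_add_le _ _

theorem dd_le_of_mem_nbrs {x y : Zn n} (h : y ∈ nbrs x) : dd x ≤ dd y + 1 := by
  obtain ⟨i, hi⟩ := mem_nbrs.1 (nbrs_symm h)
  rcases hi with rfl | rfl
  · simpa [dd_ee] using dd_add_le y (ee i)
  · have h2 : dd (-ee i : Zn n) = 1 := by
      rw [← dd_ee i]; simp [dd]
    simpa [sub_eq_add_neg, h2] using dd_add_le y (-ee i)

theorem finite_dd_lt (R : ℕ) : {x : Zn n | dd x < R}.Finite := by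
  refine (Set.finite_Icc (fun _ => -(R : ℤ)) (fun _ => (R : ℤ))).subset fun x hx => ?_
  have hi : ∀ i, (x i).natAbs < R := fun i =>
    (Finset.single_le_sum (f := fun i => (x i).natAbs) (fun _ _ => Nat.zero_le _)
      (Finset.mem_univ i)).trans_lt hx
  exact ⟨fun i => by have := hi i; show -(R : ℤ) ≤ x i; omega,
    fun i => by have := hi i; show x i ≤ R; omega⟩

theorem lap_eq (u : Zn n → ℝ) (x : Zn n) :
    lap u x = ∑ y ∈ nbrs x, u y - (nbrs x).card * u x := by
  simp [lap, Finset.sum_sub_distrib]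

theorem lap_neg (u : Zn n → ℝ) (x : Zn n) : lap (fun y => -u y) x = -lap u x := by
  simp only [lap_eq, Finset.sum_neg_distrib]; ring

/-- A nonnegative function supported in the finite set `S` has nonpositive total Laplacian
over `S`. -/
theorem sum_lap_nonpos {w : Zn n → ℝ} (hw : ∀ x, 0 ≤ w x) {S : Finset (Zn n)}
    (hS : ∀ x, x ∉ S → w x = 0) : ∑ x ∈ S, lap w x ≤ 0 := by
  have h1 : ∀ x, lap w x ≤ ∑ y ∈ S, if y ∈ nbrs x then w y - w x else 0 := by
    intro x
    rw [← Finset.sum_filter, Finset.filter_mem_eq_inter, lap,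
      ← Finset.sum_inter_add_sum_sdiff (nbrs x) S, Finset.inter_comm]
    have : ∑ y ∈ nbrs x \ S, (w y - w x) ≤ 0 :=
      Finset.sum_nonpos fun y hy => by
        have := hS y (Finset.mem_sdiff.1 hy).2
        linarith [hw x]
    linarith
  have h2 : ∑ x ∈ S, ∑ y ∈ S, (if y ∈ nbrs x then w y - w x else 0) =
      -∑ x ∈ S, ∑ y ∈ S, (if y ∈ nbrs x then w y - w x else 0) := by
    conv_lhs => rw [Finset.sum_comm]
    simp only [← Finset.sum_neg_distrib]
    refine Finset.sum_congr rfl fun x _ => Finset.sum_congr rfl fun y _ => ?_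
    simp only [mem_nbrs_comm (x := y)]
    split_ifs <;> ring
  have := Finset.sum_le_sum fun x (_ : x ∈ S) => h1 x
  linarith

theorem summable_exp_neg_mul_dd {a : ℝ} (ha : 0 < a) :
    Summable fun x : Zn n => Real.exp (-a * (dd x : ℝ)) := by
  have hZ : Summable fun k : ℤ => Real.exp (-a * (k.natAbs : ℝ)) := by
    have hN : Summable fun k : ℕ => Real.exp (-a * (k : ℝ)) := by
      simpa [mul_comm] using Real.summable_exp_nat_mul_iff.2 (neg_lt_zero.2 ha)
    exact Summable.of_nat_of_neg (by simpa using hN) (by simpa using hN)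
  have hprod : ∀ x : Zn n, Real.exp (-a * (dd x : ℝ)) =
      ∏ i, Real.exp (-a * ((x i).natAbs : ℝ)) := fun x => by
    rw [← Real.exp_sum, ← Finset.mul_sum]; simp [dd]
  refine summable_of_sum_le (c := ∏ _i : Fin n, ∑' k : ℤ, Real.exp (-a * (k.natAbs : ℝ)))
    (fun _ => (Real.exp_pos _).le) fun S => ?_
  calc ∑ x ∈ S, Real.exp (-a * (dd x : ℝ))
      ≤ ∑ x ∈ Fintype.piFinset fun i => S.image fun x => x i,
          ∏ i, Real.exp (-a * ((x i).natAbs : ℝ)) := by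
        simp only [hprod]
        refine Finset.sum_le_sum_of_subset_of_nonneg (fun x hx => ?_) fun x _ _ =>
          Finset.prod_nonneg fun _ _ => (Real.exp_pos _).le
        exact Fintype.mem_piFinset.2 fun i => Finset.mem_image_of_mem (fun x : Zn n => x i) hx
    _ = ∏ i : Fin n, ∑ k ∈ S.image (fun x => x i), Real.exp (-a * (k.natAbs : ℝ)) :=
        (Finset.prod_univ_sum (fun i => S.image fun x => x i)
          fun _ (k : ℤ) => Real.exp (-a * (k.natAbs : ℝ))).symm
    _ ≤ _ := Finset.prod_le_prod
        (fun _ _ => Finset.sum_nonneg fun _ _ => (Real.exp_pos _).le)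
        fun i _ => hZ.sum_le_tsum _ fun _ _ => (Real.exp_pos _).le

/-- `u(x) → 0` as `d(x) → ∞`. -/
def VanishesAtInfinity (u : Zn n → ℝ) : Prop :=
  ∀ ε : ℝ, 0 < ε → ∃ R : ℕ, ∀ x : Zn n, R ≤ dd x → |u x| < ε

theorem VanishesAtInfinity.of_tendsto {u : Zn n → ℝ}
    (h : Filter.Tendsto u Filter.cofinite (nhds 0)) : VanishesAtInfinity u := by
  intro ε hε
  have hfin : {x | ¬ |u x| < ε}.Finite := by
    simpa using Metric.tendsto_nhds.1 h ε hε
  obtain ⟨R, hR⟩ := (hfin.image dd).bddAbove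
  refine ⟨R + 1, fun x hx => ?_⟩
  by_contra hlt
  have := hR (Set.mem_image_of_mem dd hlt)
  omega

theorem VanishesAtInfinity.exists_bound {u : Zn n → ℝ} (h : VanishesAtInfinity u) :
    ∃ B : ℝ, ∀ x, |u x| ≤ B := by
  obtain ⟨R, hR⟩ := h 1 one_pos
  obtain ⟨B, hB⟩ := ((finite_dd_lt (n := n) R).image fun x => |u x|).bddAbove
  refine ⟨max B 1, fun x => ?_⟩
  rcases lt_or_ge (dd x) R with hx | hx
  · exact le_max_of_le_left (hB (Set.mem_image_of_mem (fun x => |u x|) hx))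
  · exact le_max_of_le_right (hR x hx).le

/-- Comparison principle for the Abelian Higgs equation. -/
theorem higgs_comparison {lam : ℝ} (hlam : 0 < lam) {g u v : Zn n → ℝ}
    (hu : ∀ x, lam * (Real.exp (u x) - 1) + g x ≤ lap u x)
    (hv : ∀ x, lap v x ≤ lam * (Real.exp (v x) - 1) + g x)
    (hu0 : VanishesAtInfinity u) (hv0 : VanishesAtInfinity v) (x : Zn n) : u x ≤ v x := by
  by_contra! hx
  obtain ⟨R₁, hR₁⟩ := hu0 ((u x - v x) / 2) (by linarith)
  obtain ⟨R₂, hR₂⟩ := hv0 ((u x - v x) / 2) (by linarith)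
  have hfar : ∀ y, max R₁ R₂ ≤ dd y → u y - v y < u x - v x := fun y hy => by
    have h1 := abs_lt.1 (hR₁ y (le_of_max_le_left hy))
    have h2 := abs_lt.1 (hR₂ y (le_of_max_le_right hy))
    linarith [h1.2, h2.1]
  have hxmem : dd x < max R₁ R₂ := by
    by_contra! h
    exact lt_irrefl _ (hfar x h)
  obtain ⟨z, -, hz⟩ := Set.exists_max_image {y : Zn n | dd y < max R₁ R₂} (fun y => u y - v y)
    (finite_dd_lt _) ⟨x, hxmem⟩
  have hmax : ∀ y, u y - v y ≤ u z - v z := fun y => by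
    rcases lt_or_ge (dd y) (max R₁ R₂) with hy | hy
    · exact hz y hy
    · exact (hfar y hy).le.trans (hz x hxmem)
  have hlap : lap u z ≤ lap v z := Finset.sum_le_sum fun y _ => by linarith [hmax y]
  have hexp : Real.exp (v z) < Real.exp (u z) := Real.exp_lt_exp.2 (by linarith [hmax x])
  nlinarith [hu z, hv z]

/-- Exponential decay of nonnegative functions `w` with `Δw ≥ λ(1 - e⁻ʷ)` off a finite set. -/
theorem exponential_decay (hn : 0 < n) {lam : ℝ} (hlam : 0 < lam) {w : Zn n → ℝ}
    (hw : ∀ x, 0 ≤ w x) (hw0 : VanishesAtInfinity w) {R₀ : ℕ}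
    (hlap : ∀ x, R₀ ≤ dd x → lam * (1 - Real.exp (-w x)) ≤ lap w x)
    {ε : ℝ} (hε : 0 < ε) (hε1 : ε < 1) :
    ∃ C : ℝ, 0 < C ∧ ∀ x, w x ≤
      C * Real.exp (-(Real.log (1 + lam / (2 * n)) * (1 - ε)) * (dd x : ℝ)) := by
  have hn' : (0 : ℝ) < 2 * n := by positivity
  set m := Real.log (1 + lam / (2 * n)) with hm
  have hq : 0 < lam / (2 * n) := by positivity
  have hmpos : 0 < m := Real.log_pos (by linarith)
  have hem : Real.exp m = 1 + lam / (2 * n) := Real.exp_log (by linarith)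
  set a := m * (1 - ε) with ha
  have hapos : 0 < a := mul_pos hmpos (by linarith)
  have ham : a < m := by nlinarith
  set θ := (Real.exp a - 1) * (2 * n) / lam with hθ
  have hθpos : 0 < θ := by
    have := Real.add_one_lt_exp hapos.ne'
    exact div_pos (mul_pos (by linarith) hn') hlam
  have hθ1 : θ < 1 := by
    rw [hθ, div_lt_one hlam]
    have h := Real.exp_lt_exp.2 ham
    rw [hem, ← sub_lt_iff_lt_add', lt_div_iff₀ hn'] at h
    exact h
  have hθlam : lam * θ = (Real.exp a - 1) * (2 * n) := by
    rw [hθ]; field_simp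
  obtain ⟨R₁, hR₁⟩ := hw0 (1 / θ - 1) (by
    have := (one_lt_div hθpos).2 hθ1
    linarith)
  obtain ⟨B, hB⟩ := hw0.exists_bound
  have hB' : ∀ x, w x ≤ B := fun x => (le_abs_self _).trans (hB x)
  have hB0 : 0 ≤ B := (hw 0).trans (hB' 0)
  set R := max R₀ R₁
  have hstep : ∀ k : ℕ, ∀ x : Zn n, R + k ≤ dd x → w x ≤ B * Real.exp (-a * k) := by
    intro k
    induction k with
    | zero => intro x _; simpa using hB' x
    | succ k ih =>
      intro x hx
      have hxR : R ≤ dd x := by omega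
      have hsmall : 1 + w x ≤ 1 / θ := by
        have := abs_lt.1 (hR₁ x ((le_max_right _ _).trans hxR))
        linarith [this.2]
      have hconc : θ * w x ≤ 1 - Real.exp (-w x) := by
        have h1 : Real.exp (-w x) ≤ 1 / (1 + w x) := by
          rw [Real.exp_neg, ← one_div]
          exact one_div_le_one_div_of_le (by linarith [hw x])
            (by linarith [Real.add_one_le_exp (w x)])
        have h2 : θ ≤ 1 / (1 + w x) := by
          rw [le_div_iff₀ (by linarith [hw x])]
          rw [le_div_iff₀ hθpos] at hsmall
          linarith
        have h3 : 1 - 1 / (1 + w x) = 1 / (1 + w x) * w x := by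
          have := hw x
          field_simp
          ring
        have h4 := mul_le_mul_of_nonneg_right h2 (hw x)
        linarith
      have hsum : ∑ y ∈ nbrs x, w y ≤ (nbrs x).card * (B * Real.exp (-a * k)) := by
        rw [← nsmul_eq_mul]
        refine Finset.sum_le_card_nsmul _ _ _ fun y hy => ih y ?_
        have := dd_le_of_mem_nbrs hy
        omega
      have hl := hlap x ((le_max_left _ _).trans hxR)
      rw [lap_eq] at hl
      have hlc := mul_le_mul_of_nonneg_left hconc hlam.le
      rw [← mul_assoc, hθlam] at hlc
      have hcard := card_nbrs_le x
      have hexp : Real.exp (-a * k) = Real.exp a * Real.exp (-a * (k + 1 : ℕ)) := by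
        rw [← Real.exp_add]; congr 1; push_cast; ring
      set D := B * Real.exp (-a * (k + 1 : ℕ)) with hD
      have hD0 : 0 ≤ D := mul_nonneg hB0 (Real.exp_pos _).le
      have hBD : B * Real.exp (-a * k) = Real.exp a * D := by rw [hexp, hD]; ring
      rw [hBD] at hsum
      have hea : 0 < Real.exp a - 1 := by linarith [Real.add_one_lt_exp hapos.ne']
      by_contra! hlt
      have hK : (0 : ℝ) ≤ (nbrs x).card := Nat.cast_nonneg _
      have h1 : (nbrs x).card * w x + (Real.exp a - 1) * (2 * n) * w x
          ≤ (nbrs x).card * (Real.exp a * D) := by linarith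
      have h2 : (nbrs x).card * D ≤ (nbrs x).card * w x :=
        mul_le_mul_of_nonneg_left hlt.le hK
      have h3 : (Real.exp a - 1) * (2 * n) * D < (Real.exp a - 1) * (2 * n) * w x :=
        mul_lt_mul_of_pos_left hlt (mul_pos hea hn')
      have h4 : (Real.exp a - 1) * D * (nbrs x).card ≤ (Real.exp a - 1) * D * (2 * n) :=
        mul_le_mul_of_nonneg_left hcard (mul_nonneg hea.le hD0)
      nlinarith
  refine ⟨(B + 1) * Real.exp (a * R), by positivity, fun x => ?_⟩
  rw [mul_assoc, ← Real.exp_add]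
  have hC : ∀ t s : ℝ, t ≤ s → B * Real.exp t ≤ (B + 1) * Real.exp s := fun t s hts =>
    mul_le_mul (by linarith) (Real.exp_le_exp.2 hts) (Real.exp_pos _).le (by linarith)
  rcases le_total R (dd x) with hx | hx
  · refine (hstep (dd x - R) x (by omega)).trans (hC _ _ ?_)
    rw [Nat.cast_sub hx]
    exact le_of_eq (by ring)
  · refine ((hB' x).trans_eq (by simp)).trans (hC 0 _ ?_)
    have : (dd x : ℝ) ≤ R := by exact_mod_cast hx
    nlinarith

end Lattice

section Iteration

variable {n : ℕ}

/-- Monotone iteration started at `0` for the equation `Δw = λ(1 - e⁻ʷ) - g`. -/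
noncomputable def higgsIter (lam : ℝ) (g : Zn n → ℝ) : ℕ → Zn n → ℝ
  | 0 => fun _ => 0
  | k + 1 => fun x => (g x + ∑ y ∈ nbrs x, higgsIter lam g k y +
      lam * (higgsIter lam g k x - 1 + Real.exp (-higgsIter lam g k x))) / ((nbrs x).card + lam)

theorem sub_one_add_exp_neg_le {s t : ℝ} (hs : 0 ≤ s) (hst : s ≤ t) :
    s - 1 + Real.exp (-s) ≤ t - 1 + Real.exp (-t) := by
  have h1 : Real.exp (-t) = Real.exp (-s) * Real.exp (-(t - s)) := by
    rw [← Real.exp_add]; congr 1; ring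
  have h2 := Real.add_one_le_exp (-(t - s))
  have h3 : Real.exp (-s) ≤ 1 := Real.exp_le_one_iff.2 (by linarith)
  nlinarith [Real.exp_pos (-s)]

variable {lam : ℝ} (hlam : 0 < lam) {g : Zn n → ℝ} (hg : ∀ x, 0 ≤ g x)
include hlam

theorem higgsIter_succ_mul (k : ℕ) (x : Zn n) :
    higgsIter lam g (k + 1) x * ((nbrs x).card + lam) = g x + ∑ y ∈ nbrs x, higgsIter lam g k y +
      lam * (higgsIter lam g k x - 1 + Real.exp (-higgsIter lam g k x)) := by
  rw [higgsIter]
  exact div_mul_cancel₀ _ (by positivity)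

include hg

theorem higgsIter_nonneg (k : ℕ) (x : Zn n) : 0 ≤ higgsIter lam g k x := by
  induction k generalizing x with
  | zero => simp [higgsIter]
  | succ k ih =>
    have h1 := sub_one_add_exp_neg_le le_rfl (ih x)
    simp only [neg_zero, Real.exp_zero] at h1
    rw [higgsIter]
    exact div_nonneg (add_nonneg (add_nonneg (hg x) (Finset.sum_nonneg fun y _ => ih y))
      (mul_nonneg hlam.le (by linarith))) (by positivity)

theorem higgsIter_le_succ (k : ℕ) (x : Zn n) : higgsIter lam g k x ≤ higgsIter lam g (k + 1) x := by
  induction k generalizing x with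
  | zero => exact higgsIter_nonneg hlam hg 1 x
  | succ k ih =>
    have h1 := sub_one_add_exp_neg_le (higgsIter_nonneg hlam hg k x) (ih x)
    have h2 := Finset.sum_le_sum fun y (_ : y ∈ nbrs x) => ih y
    have h3 := mul_le_mul_of_nonneg_left h1 hlam.le
    refine le_of_mul_le_mul_right ?_ (by positivity : 0 < ((nbrs x).card + lam : ℝ))
    rw [higgsIter_succ_mul hlam, higgsIter_succ_mul hlam]
    linarith

theorem higgsIter_mono (x : Zn n) : Monotone fun k => higgsIter lam g k x :=
  monotone_nat_of_le_succ fun k => higgsIter_le_succ hlam hg k x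

theorem higgsIter_subsolution (k : ℕ) (x : Zn n) :
    lam * (1 - Real.exp (-higgsIter lam g k x)) ≤ g x + lap (higgsIter lam g k) x := by
  have h1 := higgsIter_succ_mul hlam (g := g) k x
  have h2 := mul_le_mul_of_nonneg_right (higgsIter_le_succ hlam hg k x)
    (by positivity : 0 ≤ ((nbrs x).card + lam : ℝ))
  rw [lap_eq]
  linarith

theorem higgsIter_le_of_mem_nbrs (k : ℕ) {x y : Zn n} (hy : y ∈ nbrs x) :
    higgsIter lam g k y ≤ higgsIter lam g (k + 1) x * ((nbrs x).card + lam) := by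
  have h1 := sub_one_add_exp_neg_le le_rfl (higgsIter_nonneg hlam hg k x)
  simp only [neg_zero, Real.exp_zero] at h1
  have h2 := Finset.single_le_sum (fun y _ => higgsIter_nonneg hlam hg k y) hy
  rw [higgsIter_succ_mul hlam]
  nlinarith [hg x]

omit hlam hg in
theorem higgsIter_finite_support {T : Finset (Zn n)} (hT : ∀ x, x ∉ T → g x = 0) (k : ℕ) :
    ∃ S : Finset (Zn n), ∀ x, x ∉ S → higgsIter lam g k x = 0 := by
  induction k with
  | zero => exact ⟨∅, fun x _ => rfl⟩
  | succ k ih =>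
    obtain ⟨S, hS⟩ := ih
    refine ⟨T ∪ (S ∪ S.biUnion nbrs), fun x hx => ?_⟩
    simp only [Finset.mem_union, Finset.mem_biUnion, not_or, not_exists, not_and] at hx
    obtain ⟨h1, h2, h3⟩ := hx
    have hsum : ∑ y ∈ nbrs x, higgsIter lam g k y = 0 :=
      Finset.sum_eq_zero fun y hy => hS y fun hyS => h3 y hyS (nbrs_symm hy)
    simp [higgsIter, hT x h1, hS x h2, hsum]

theorem sum_higgsIter_le {T : Finset (Zn n)} (hT : ∀ x, x ∉ T → g x = 0) (k : ℕ)
    (S : Finset (Zn n)) :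
    ∑ x ∈ S, lam * (1 - Real.exp (-higgsIter lam g k x)) ≤ ∑ x ∈ T, g x := by
  obtain ⟨S', hS'⟩ := higgsIter_finite_support (lam := lam) hT k
  have h0 : ∀ x, 0 ≤ lam * (1 - Real.exp (-higgsIter lam g k x)) := fun x =>
    mul_nonneg hlam.le (sub_nonneg.2
      (Real.exp_le_one_iff.2 (neg_nonpos.2 (higgsIter_nonneg hlam hg k x))))
  calc ∑ x ∈ S, lam * (1 - Real.exp (-higgsIter lam g k x))
      ≤ ∑ x ∈ S ∪ S' ∪ T, lam * (1 - Real.exp (-higgsIter lam g k x)) :=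
        Finset.sum_le_sum_of_subset_of_nonneg (by grind) fun x _ _ => h0 x
    _ ≤ ∑ x ∈ S ∪ S' ∪ T, (g x + lap (higgsIter lam g k) x) :=
        Finset.sum_le_sum fun x _ => higgsIter_subsolution hlam hg k x
    _ ≤ ∑ x ∈ S ∪ S' ∪ T, g x := by
        rw [Finset.sum_add_distrib]
        have := sum_lap_nonpos (higgsIter_nonneg hlam hg k) (S := S ∪ S' ∪ T)
          fun x hx => hS' x (by grind)
        linarith
    _ = ∑ x ∈ T, g x :=
        (Finset.sum_subset Finset.subset_union_right fun x _ hx => hT x hx).symm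

theorem higgsIter_bddAbove (hn : 0 < n) {T : Finset (Zn n)} (hT : ∀ x, x ∉ T → g x = 0)
    (x : Zn n) : BddAbove (Set.range fun k => higgsIter lam g k x) := by
  by_contra hx
  have hnbr : ∀ x y : Zn n, y ∈ nbrs x →
      BddAbove (Set.range fun k => higgsIter lam g k x) →
      BddAbove (Set.range fun k => higgsIter lam g k y) := by
    rintro x y hy ⟨B, hB⟩
    refine ⟨B * ((nbrs x).card + lam), ?_⟩
    rintro _ ⟨k, rfl⟩
    exact (higgsIter_le_of_mem_nbrs hlam hg k hy).trans
      (mul_le_mul_of_nonneg_right (hB ⟨k + 1, rfl⟩) (by positivity))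
  let e : Zn n := ee ⟨0, hn⟩
  have hline : ∀ j : ℕ, ¬ BddAbove (Set.range fun k => higgsIter lam g k (x + j • e)) := by
    intro j
    induction j with
    | zero => simpa using hx
    | succ j ih =>
      refine fun h => ih (hnbr _ _ (mem_nbrs.2 ⟨⟨0, hn⟩, Or.inr ?_⟩) h)
      show x + j • e = x + (j + 1) • e - e
      rw [succ_nsmul]; abel
  have hinj : Function.Injective fun j : ℕ => x + j • e := by
    intro i j hij
    have := congrFun hij ⟨0, hn⟩
    simpa [e, ee] using this
  have htend : ∀ j : ℕ, Filter.Tendsto (fun k => higgsIter lam g k (x + j • e)) Filter.atTop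
      Filter.atTop := fun j =>
    Filter.tendsto_atTop_atTop_of_monotone' (higgsIter_mono hlam hg _) (hline j)
  obtain ⟨N, hN⟩ := exists_nat_gt ((∑ x ∈ T, g x) / (lam / 2))
  rw [div_lt_iff₀ (by positivity)] at hN
  have hev : ∀ᶠ k in Filter.atTop, ∀ j ∈ Finset.range N,
      1 ≤ higgsIter lam g k (x + j • e) :=
    (Filter.eventually_all_finset _).2 fun j _ => (htend j).eventually_ge_atTop 1
  obtain ⟨k, hk⟩ := hev.exists
  have hsum := sum_higgsIter_le hlam hg hT k ((Finset.range N).image fun j : ℕ => x + j • e)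
  rw [Finset.sum_image fun i _ j _ h => hinj h] at hsum
  have hlow : ∑ _j ∈ Finset.range N, lam / 2 ≤
      ∑ j ∈ Finset.range N, lam * (1 - Real.exp (-higgsIter lam g k (x + j • e))) := by
    refine Finset.sum_le_sum fun j hj => ?_
    have h1 : Real.exp (-higgsIter lam g k (x + j • e)) ≤ 1 / 2 := by
      rw [Real.exp_neg, ← one_div]
      exact one_div_le_one_div_of_le two_pos
        (by linarith [Real.add_one_le_exp (higgsIter lam g k (x + j • e)), hk j hj])
    nlinarith
  rw [Finset.sum_const, Finset.card_range, nsmul_eq_mul] at hlow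
  linarith

/-- Existence of a nonnegative solution of `Δw = λ(1 - e⁻ʷ) - g` vanishing at infinity. -/
theorem exists_higgs_solution (hn : 0 < n) {T : Finset (Zn n)} (hT : ∀ x, x ∉ T → g x = 0) :
    ∃ w : Zn n → ℝ, (∀ x, 0 ≤ w x) ∧ VanishesAtInfinity w ∧
      ∀ x, lap w x = lam * (1 - Real.exp (-w x)) - g x := by
  have hlim : ∀ x, Filter.Tendsto (fun k => higgsIter lam g k x) Filter.atTop
      (nhds (⨆ k, higgsIter lam g k x)) := fun x =>
    tendsto_atTop_ciSup (higgsIter_mono hlam hg x) (higgsIter_bddAbove hlam hg hn hT x)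
  set w : Zn n → ℝ := fun x => ⨆ k, higgsIter lam g k x
  have hw : ∀ x, 0 ≤ w x := fun x =>
    ge_of_tendsto' (hlim x) fun k => higgsIter_nonneg hlam hg k x
  have hexp : ∀ x, Filter.Tendsto (fun k => Real.exp (-higgsIter lam g k x)) Filter.atTop
      (nhds (Real.exp (-w x))) := fun x => (Real.continuous_exp.tendsto _).comp (hlim x).neg
  have hsum : Summable fun x => lam * (1 - Real.exp (-w x)) := by
    refine summable_of_sum_le (c := ∑ x ∈ T, g x) (fun x => mul_nonneg hlam.le (sub_nonneg.2
      (Real.exp_le_one_iff.2 (neg_nonpos.2 (hw x))))) fun S => ?_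
    exact le_of_tendsto' (tendsto_finsetSum S fun x _ => ((hexp x).const_sub 1).const_mul lam)
      fun k => sum_higgsIter_le hlam hg hT k S
  refine ⟨w, hw, .of_tendsto ?_, fun x => ?_⟩
  · have h1 : Filter.Tendsto (fun x => Real.exp (-w x)) Filter.cofinite (nhds 1) := by
      have := (hsum.tendsto_cofinite_zero.const_mul lam⁻¹).const_sub 1
      simpa [hlam.ne'] using this
    have h2 := (h1.log one_ne_zero).neg
    simpa using h2
  · have h1 := ((hlim x).comp (Filter.tendsto_add_atTop_nat 1)).mul_const ((nbrs x).card + lam)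
    have h2 := ((tendsto_finsetSum (nbrs x) fun y _ => hlim y).const_add (g x)).add
      ((((hlim x).sub_const 1).add (hexp x)).const_mul lam)
    have h3 := tendsto_nhds_unique h1 (h2.congr fun k => (higgsIter_succ_mul hlam k x).symm)
    rw [lap_eq]
    show ∑ y ∈ nbrs x, (⨆ k, higgsIter lam g k y) - _ * (⨆ k, higgsIter lam g k x) =
      lam * (1 - Real.exp (-⨆ k, higgsIter lam g k x)) - g x
    linarith

end Iteration

/-- Existence and uniqueness of the topological solution to the Abelian Higgs equation on `ℤⁿ`. -/
theorem stmt1 (n : ℕ) (hn : 2 ≤ n) (lam : ℝ) (hlam : 0 < lam)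
    (M : ℕ) (hM : 1 ≤ M) (nn : Fin M → ℕ) (hnn : ∀ j, 0 < nn j)
    (p : Fin M → Zn n) (hp : Function.Injective p)
    (g : Zn n → ℝ)
    (hg : ∀ x, g x = ∑ j, if x = p j then 4 * Real.pi * (nn j : ℝ) else 0) :
    ∃ u' : Zn n → ℝ,
      -- u' solves the Abelian Higgs equation
      (∀ x, lap u' x = lam * (Real.exp (u' x) - 1) + g x) ∧
      -- u'(x) → 0 as d(x) → ∞
      (∀ ε : ℝ, 0 < ε → ∃ R : ℕ, ∀ x : Zn n, R ≤ dd x → |u' x| < ε) ∧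
      -- uniqueness among topological solutions
      (∀ v : Zn n → ℝ,
        (∀ x, lap v x = lam * (Real.exp (v x) - 1) + g x) →
        (∀ ε : ℝ, 0 < ε → ∃ R : ℕ, ∀ x : Zn n, R ≤ dd x → |v x| < ε) →
        ∀ x, v x = u' x) ∧
      -- u' ≤ 0
      (∀ x, u' x ≤ 0) ∧
      -- u' ∈ l^p for every 1 ≤ p < ∞ and for p = ∞
      (∀ q : ℝ, 1 ≤ q → Summable (fun x : Zn n => |u' x| ^ q)) ∧
      (∃ B : ℝ, ∀ x : Zn n, |u' x| ≤ B) ∧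
      -- every topological solution of the Chern–Simons equation lies below u'
      (∀ u : Zn n → ℝ,
        (∀ x, lap u x = lam * (Real.exp (u x) * (Real.exp (u x) - 1)) + g x) →
        (∀ ε : ℝ, 0 < ε → ∃ R : ℕ, ∀ x : Zn n, R ≤ dd x → |u x| < ε) →
        ∀ x, u x ≤ u' x) ∧
      -- the decay estimate with m = ln(1 + λ/(2n))
      (∀ ε : ℝ, 0 < ε → ε < 1 → ∃ C : ℝ, 0 < C ∧ ∀ x : Zn n,
        |u' x| ≤ C * Real.exp (-(Real.log (1 + lam / (2 * n)) * (1 - ε)) * (dd x : ℝ))) := by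
  have hg0 : ∀ x, 0 ≤ g x := fun x => by
    rw [hg]
    exact Finset.sum_nonneg fun j _ => by split_ifs <;> positivity
  have hT : ∀ x, x ∉ Finset.univ.image p → g x = 0 := fun x hx => by
    rw [hg]
    refine Finset.sum_eq_zero fun j _ => if_neg ?_
    rintro rfl
    exact hx (Finset.mem_image_of_mem p (Finset.mem_univ j))
  have hn0 : 0 < n := by omega
  obtain ⟨w, hw, hw0, hlap⟩ := exists_higgs_solution hlam hg0 hn0 hT
  have hsol : ∀ x, lap (fun x => -w x) x = lam * (Real.exp (-w x) - 1) + g x := fun x => by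
    rw [lap_neg, hlap]; ring
  have hvan : VanishesAtInfinity fun x => -w x := fun ε hε => by simpa using hw0 ε hε
  obtain ⟨R₀, hR₀⟩ := ((Finset.univ.image p).finite_toSet.image dd).bddAbove
  have hdecay : ∀ ε : ℝ, 0 < ε → ε < 1 → ∃ C : ℝ, 0 < C ∧ ∀ x : Zn n,
      |(-w x)| ≤ C * Real.exp (-(Real.log (1 + lam / (2 * n)) * (1 - ε)) * (dd x : ℝ)) := by
    intro ε hε hε1
    obtain ⟨C, hC, h⟩ := exponential_decay hn0 hlam hw hw0 (R₀ := R₀ + 1) (fun x hx => by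
      rw [hlap, hT x fun hxT => ?_, sub_zero]
      have := hR₀ (Set.mem_image_of_mem dd (Finset.mem_coe.2 hxT))
      omega) hε hε1
    exact ⟨C, hC, fun x => by rw [abs_neg, abs_of_nonneg (hw x)]; exact h x⟩
  refine ⟨fun x => -w x, hsol, hvan, fun v hv hv0 x => ?_, fun x => neg_nonpos.2 (hw x),
    fun q hq => ?_, hvan.exists_bound, fun u hu hu0 => ?_, hdecay⟩
  · exact le_antisymm
      (higgs_comparison hlam (fun y => (hv y).ge) (fun y => (hsol y).le) hv0 hvan x)
      (higgs_comparison hlam (fun y => (hsol y).ge) (fun y => (hv y).le) hvan hv0 x)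
  · obtain ⟨C, hC, h⟩ := hdecay (1 / 2) (by norm_num) (by norm_num)
    set a := Real.log (1 + lam / (2 * n)) * (1 - 1 / 2) with ha
    have hapos : 0 < a := by
      have : 0 < lam / (2 * n) := by positivity
      exact mul_pos (Real.log_pos (by linarith)) (by norm_num)
    have hq0 : 0 < q := by linarith
    refine .of_nonneg_of_le (fun x => by positivity) (fun x => ?_)
      ((summable_exp_neg_mul_dd (n := n) (mul_pos hapos hq0)).mul_left (C ^ q))
    refine (Real.rpow_le_rpow (abs_nonneg _) (h x) hq0.le).trans_eq ?_
    rw [Real.mul_rpow hC.le (Real.exp_pos _).le, ← Real.exp_mul]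
    congr 2
    ring
  · refine higgs_comparison hlam (fun y => ?_) (fun y => (hsol y).le) hu0 hvan
    rw [hu]
    nlinarith [mul_nonneg hlam.le (sq_nonneg (Real.exp (u y) - 1))]
end

section
/- Isoperimetric inequality on ℤⁿ: for every n ≥ 2 there exists a constant C_n > 0, depending only on n, such that for every nonempty finite subset Ω ⊂ ℤⁿ, |δΩ| ≥ C_n |Ω|^{(n−1)/n}, where |·| denotes cardinality. -/
open Real

/-- Every coordinate line through a point of a finite set meets the boundary of that set. -/
lemma exists_update_mem_bdry {n : ℕ} {Ω : Finset (Zn n)} {x : Zn n} (hx : x ∈ Ω) (i : Fin n) :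
    ∃ t : ℤ, Function.update x i t ∈ bdry Ω := by
  have hinj : Function.Injective fun k : ℕ => Function.update x i (x i + k) := fun a b hab => by
    have := Function.update_injective x i hab
    omega
  have hex : ∃ k : ℕ, Function.update x i (x i + k) ∉ Ω := by
    by_contra! h
    exact Set.infinite_range_of_injective hinj
      (Ω.finite_toSet.subset (Set.range_subset_iff.2 h))
  classical
  obtain ⟨k, hk⟩ : ∃ k, Nat.find hex = k + 1 := Nat.exists_eq_succ_of_ne_zero fun h0 => by
    have := Nat.find_spec hex
    simp [h0, hx] at this
  have hout := Nat.find_spec hex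
  have hin : Function.update x i (x i + k) ∈ Ω :=
    not_not.1 (Nat.find_min hex (m := k) (by omega))
  rw [hk] at hout
  refine ⟨_, Finset.mem_sdiff.2 ⟨Finset.mem_biUnion.2 ⟨_, hin, ?_⟩, hout⟩⟩
  refine Finset.mem_union_left _ (Finset.mem_image.2 ⟨i, Finset.mem_univ i, ?_⟩)
  ext j
  by_cases hj : j = i
  · subst hj
    simp [ee, add_assoc]
  · simp [ee, hj]

open MeasureTheory in
/-- The product of counting measures on a countable type is the counting measure. -/
lemma pi_count_eq_count {ι α : Type*} [Fintype ι] [Countable α] [MeasurableSpace α]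
    [MeasurableSingletonClass α] :
    Measure.pi (fun _ : ι => (Measure.count : Measure α)) = Measure.count := by
  refine Measure.ext_of_singleton fun x => ?_
  simp [Measure.pi_singleton]

open MeasureTheory in
/-- A Loomis-Whitney type bound: if every coordinate line through a point of `s` meets `t`,
then `|s| ≤ |t|^(n/(n-1))`. -/
lemma card_le_card_rpow_of_forall_exists_update_mem {n : ℕ} {p : ℝ}
    (hp : Real.HolderConjugate n p) {s t : Finset (Zn n)}
    (h : ∀ x ∈ s, ∀ i, ∃ a : ℤ, Function.update x i a ∈ t) :
    (s.card : ℝ) ≤ (t.card : ℝ) ^ p := by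
  set f : Zn n → ENNReal := (t : Set (Zn n)).indicator 1
  have key := lintegral_prod_lintegral_pow_le (ι := Fin n) (A := fun _ => ℤ)
    (fun _ => Measure.count) (p := p) (by simpa using hp) (f := f)
    (measurable_of_countable f)
  rw [pi_count_eq_count] at key
  have hn : (1 : ℝ) < n := hp.lt
  have hf : ∫⁻ x, f x ∂Measure.count = t.card := by
    rw [lintegral_indicator_one t.measurableSet, Measure.count_apply_finset]
  have hs : (s.card : ENNReal) ≤ ∫⁻ x : Zn n, ∏ i, (∫⁻ a, f (Function.update x i a)
      ∂Measure.count) ^ ((1 : ℝ) / (Fintype.card (Fin n) - 1 : ℝ)) ∂Measure.count := by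
    rw [← Measure.count_apply_finset s, ← lintegral_indicator_one s.measurableSet]
    refine lintegral_mono fun x => ?_
    by_cases hx : x ∈ s
    swap
    · simp [hx]
    simp only [Finset.mem_coe, hx, Set.indicator_of_mem, Pi.one_apply]
    refine Finset.one_le_prod' fun i _ => ?_
    obtain ⟨a, ha⟩ := h x hx i
    refine ENNReal.one_le_rpow ?_ (by simpa using hn)
    rw [lintegral_count]
    exact le_trans (by simp [f, ha]) (ENNReal.le_tsum a)
  have hst := hs.trans key
  rw [hf] at hst
  have := ENNReal.toReal_mono (by simp [hp.symm.nonneg]) hst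
  simpa [← ENNReal.toReal_rpow] using this

/-- Isoperimetric inequality on `ℤⁿ`: `|δΩ| ≥ C_n |Ω|^{(n-1)/n}`. -/
theorem stmt6 (n : ℕ) (hn : 2 ≤ n) :
    ∃ C : ℝ, 0 < C ∧ ∀ Ω : Finset (Zn n), Ω.Nonempty →
      C * (Ω.card : ℝ) ^ (((n : ℝ) - 1) / n) ≤ ((bdry Ω).card : ℝ) := by
  have hn1 : (1 : ℝ) < n := by exact_mod_cast hn
  refine ⟨1, one_pos, fun Ω _ => ?_⟩
  have hp := Real.HolderConjugate.conjExponent hn1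
  have hp0 := hp.symm.pos
  have hexp : ((n : ℝ) - 1) / n = (Real.conjExponent n)⁻¹ := by
    rw [Real.conjExponent, inv_div]
  rw [one_mul, hexp, Real.rpow_inv_le_iff_of_pos (by positivity) (by positivity) hp0]
  exact card_le_card_rpow_of_forall_exists_update_mem hp fun x hx => exists_update_mem_bdry hx
end

section
/- The Chern–Simons iteration is well defined and monotone: for every k ≥ 1 there exists a unique u_k : Ω̄ → ℝ with (Δ − K)u_k = λ e^{u_{k−1}}(e^{u_{k−1}} − 1) + g − K u_{k−1} on Ω and u_k = 0 on δΩ, and the resulting sequence satisfies 0 = u₀ ≥ u₁ ≥ u₂ ≥ … pointwise on Ω̄. -/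
open Real

/-- `Ω` is connected in the graph sense. -/
def connFinset {n : ℕ} (Ω : Finset (Zn n)) : Prop :=
  ∀ x ∈ Ω, ∀ y ∈ Ω, ∃ (m : ℕ) (c : ℕ → Zn n),
    c 0 = x ∧ c m = y ∧ (∀ i ≤ m, c i ∈ Ω) ∧ ∀ i < m, c (i + 1) ∈ nbrs (c i)

lemma lap_sub {n : ℕ} (u v : Zn n → ℝ) (x : Zn n) :
    lap (fun y => u y - v y) x = lap u x - lap v x := by
  simp only [lap, ← Finset.sum_sub_distrib]
  exact Finset.sum_congr rfl fun y _ => by ring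

lemma mem_clos_of_mem_nbrs {n : ℕ} {Ω : Finset (Zn n)} {x y : Zn n} (hx : x ∈ Ω)
    (hy : y ∈ nbrs x) : y ∈ clos Ω := by
  by_cases h : y ∈ Ω
  · exact Finset.mem_union_left _ h
  · exact Finset.mem_union_right _ (Finset.mem_sdiff.2 ⟨Finset.mem_biUnion.2 ⟨x, hx, hy⟩, h⟩)

/-- The maximum principle for `Δ - K` with `K > 0`. -/
lemma nonpos_of_lap_sub_mul_nonneg {n : ℕ} {Ω : Finset (Zn n)} {K : ℝ} (hK : 0 < K)
    {v : Zn n → ℝ} (hv : ∀ x ∈ Ω, 0 ≤ lap v x - K * v x) (hb : ∀ x ∈ bdry Ω, v x ≤ 0) :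
    ∀ x ∈ clos Ω, v x ≤ 0 := by
  intro x hx
  obtain ⟨m, hm, hmax⟩ := (clos Ω).exists_max_image v ⟨x, hx⟩
  refine (hmax x hx).trans ?_
  rcases Finset.mem_union.1 hm with h | h
  · have hlap : lap v m ≤ 0 := Finset.sum_nonpos fun y hy =>
      sub_nonpos.2 (hmax y (mem_clos_of_mem_nbrs h hy))
    have := hv m h
    by_contra! hpos
    nlinarith [mul_pos hK hpos]
  · exact hb m h

lemma eq_of_lap_sub_mul_eq {n : ℕ} {Ω : Finset (Zn n)} {K : ℝ} (hK : 0 < K)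
    {v w : Zn n → ℝ} (h : ∀ x ∈ Ω, lap v x - K * v x = lap w x - K * w x)
    (hb : ∀ x ∈ bdry Ω, v x = w x) : ∀ x ∈ clos Ω, v x = w x := by
  intro x hx
  have h₁ := nonpos_of_lap_sub_mul_nonneg hK (v := fun y => v y - w y)
    (fun y hy => by rw [lap_sub]; linarith [h y hy]) (fun y hy => by linarith [hb y hy]) x hx
  have h₂ := nonpos_of_lap_sub_mul_nonneg hK (v := fun y => w y - v y)
    (fun y hy => by rw [lap_sub]; linarith [h y hy]) (fun y hy => by linarith [hb y hy]) x hx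
  linarith

/-- The extension by zero of a function on `Ω` to all of `ℤⁿ`. -/
noncomputable def extendZero {n : ℕ} (Ω : Finset (Zn n)) (f : Ω → ℝ) (x : Zn n) : ℝ :=
  if h : x ∈ Ω then f ⟨x, h⟩ else 0

lemma extendZero_coe {n : ℕ} {Ω : Finset (Zn n)} (f : Ω → ℝ) (x : Ω) :
    extendZero Ω f x = f x := by
  simp [extendZero]

lemma extendZero_of_notMem {n : ℕ} {Ω : Finset (Zn n)} (f : Ω → ℝ) {x : Zn n} (hx : x ∉ Ω) :
    extendZero Ω f x = 0 := by
  simp [extendZero, hx]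

lemma extendZero_add {n : ℕ} {Ω : Finset (Zn n)} (f₁ f₂ : Ω → ℝ) (x : Zn n) :
    extendZero Ω (f₁ + f₂) x = extendZero Ω f₁ x + extendZero Ω f₂ x := by
  by_cases h : x ∈ Ω <;> simp [extendZero, h]

lemma extendZero_smul {n : ℕ} {Ω : Finset (Zn n)} (c : ℝ) (f : Ω → ℝ) (x : Zn n) :
    extendZero Ω (c • f) x = c * extendZero Ω f x := by
  by_cases h : x ∈ Ω <;> simp [extendZero, h]

/-- The operator `Δ - K` on functions on `Ω` with zero Dirichlet boundary values. -/
noncomputable def dirichletOp {n : ℕ} (Ω : Finset (Zn n)) (K : ℝ) : (Ω → ℝ) →ₗ[ℝ] (Ω → ℝ) where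
  toFun f x := lap (extendZero Ω f) x - K * extendZero Ω f x
  map_add' f₁ f₂ := by
    ext x
    have : lap (extendZero Ω (f₁ + f₂)) x =
        lap (extendZero Ω f₁) x + lap (extendZero Ω f₂) x := by
      simp only [lap, extendZero_add, ← Finset.sum_add_distrib]
      exact Finset.sum_congr rfl fun y _ => by ring
    simp only [Pi.add_apply, this, extendZero_add]
    ring
  map_smul' c f := by
    ext x
    have : lap (extendZero Ω (c • f)) x = c * lap (extendZero Ω f) x := by
      simp only [lap, extendZero_smul, Finset.mul_sum]
      exact Finset.sum_congr rfl fun y _ => by ring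
    simp only [Pi.smul_apply, smul_eq_mul, RingHom.id_apply, this, extendZero_smul]
    ring

lemma notMem_of_mem_bdry {n : ℕ} {Ω : Finset (Zn n)} {x : Zn n} (hx : x ∈ bdry Ω) : x ∉ Ω :=
  (Finset.mem_sdiff.1 hx).2

lemma dirichletOp_surjective {n : ℕ} (Ω : Finset (Zn n)) {K : ℝ} (hK : 0 < K) :
    Function.Surjective (dirichletOp Ω K) := by
  refine LinearMap.injective_iff_surjective.1 fun f₁ f₂ h => funext fun x => ?_
  rw [← extendZero_coe f₁, ← extendZero_coe f₂]
  refine eq_of_lap_sub_mul_eq hK (fun y hy => congrFun h ⟨y, hy⟩) (fun y hy => ?_) x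
    (Finset.mem_union_left _ x.2)
  rw [extendZero_of_notMem _ (notMem_of_mem_bdry hy),
    extendZero_of_notMem _ (notMem_of_mem_bdry hy)]

lemma exists_dirichlet_solution {n : ℕ} (Ω : Finset (Zn n)) {K : ℝ} (hK : 0 < K)
    (f : Zn n → ℝ) :
    ∃ v : Zn n → ℝ, (∀ x ∈ Ω, lap v x - K * v x = f x) ∧ ∀ x ∈ bdry Ω, v x = 0 := by
  obtain ⟨v, hv⟩ := dirichletOp_surjective Ω hK fun x => f x
  exact ⟨extendZero Ω v, fun x hx => congrFun hv ⟨x, hx⟩,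
    fun x hx => extendZero_of_notMem _ (notMem_of_mem_bdry hx)⟩

/-- One-sided Lipschitz bound for the Chern–Simons nonlinearity on `(-∞, 0]`. -/
lemma exp_mul_exp_sub_one_sub_le_s9 {a b : ℝ} (hab : a ≤ b) (hb : b ≤ 0) :
    exp b * (exp b - 1) - exp a * (exp a - 1) ≤ b - a := by
  have hA : exp a ≤ exp b := exp_le_exp.2 hab
  have hB : exp b ≤ 1 := exp_le_one_iff.2 hb
  have hmul : exp b * exp (a - b) = exp a := by rw [← exp_add]; ring_nf
  have hdiff : exp b - exp a ≤ b - a := by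
    nlinarith [add_one_le_exp (a - b), exp_pos b]
  nlinarith

/-- The Chern–Simons iteration on a finite connected subset is well defined and monotone. -/
theorem stmt9 (n : ℕ) (hn : 2 ≤ n) (lam : ℝ) (hlam : 0 < lam)
    (M : ℕ) (hM : 1 ≤ M) (nn : Fin M → ℕ) (hnn : ∀ j, 0 < nn j)
    (p : Fin M → Zn n) (hp : Function.Injective p)
    (g : Zn n → ℝ)
    (hg : ∀ x, g x = ∑ j, if x = p j then 4 * Real.pi * (nn j : ℝ) else 0)
    (K : ℝ) (hK : 2 * lam < K)
    (Ω : Finset (Zn n)) (hΩp : ∀ j, p j ∈ Ω) (hconn : connFinset Ω) :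
    ∃ U : ℕ → Zn n → ℝ,
      -- u₀ = 0 on Ω̄
      (∀ x ∈ clos Ω, U 0 x = 0) ∧
      -- each uₖ, k ≥ 1, solves the iteration step
      (∀ k : ℕ, ∀ x ∈ Ω,
        lap (U (k + 1)) x - K * U (k + 1) x
          = lam * (Real.exp (U k x) * (Real.exp (U k x) - 1)) + g x - K * U k x) ∧
      (∀ k : ℕ, ∀ x ∈ bdry Ω, U (k + 1) x = 0) ∧
      -- uniqueness of each iteration step (as functions on Ω̄)
      (∀ k : ℕ, ∀ v w : Zn n → ℝ,
        (∀ x ∈ Ω, lap v x - K * v x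
          = lam * (Real.exp (U k x) * (Real.exp (U k x) - 1)) + g x - K * U k x) →
        (∀ x ∈ bdry Ω, v x = 0) →
        (∀ x ∈ Ω, lap w x - K * w x
          = lam * (Real.exp (U k x) * (Real.exp (U k x) - 1)) + g x - K * U k x) →
        (∀ x ∈ bdry Ω, w x = 0) →
        ∀ x ∈ clos Ω, v x = w x) ∧
      -- monotonicity: 0 = u₀ ≥ u₁ ≥ u₂ ≥ … on Ω̄
      (∀ k : ℕ, ∀ x ∈ clos Ω, U (k + 1) x ≤ U k x) := by
  have hK₀ : 0 < K := by linarith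
  choose S hS hSb using fun f : Zn n → ℝ => exists_dirichlet_solution Ω hK₀ f
  let F : (Zn n → ℝ) → Zn n → ℝ := fun u x => lam * (exp (u x) * (exp (u x) - 1)) + g x - K * u x
  let U : ℕ → Zn n → ℝ := fun k => Nat.rec 0 (fun _ u => S (F u)) k
  have hU : ∀ k, ∀ x ∈ Ω, lap (U (k + 1)) x - K * U (k + 1) x = F (U k) x :=
    fun k => hS (F (U k))
  have hUb : ∀ k, ∀ x ∈ bdry Ω, U k x = 0 := by
    intro k x hx
    cases k with
    | zero => rfl
    | succ k => exact hSb (F (U k)) x hx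
  have hg₀ : ∀ x, 0 ≤ g x := by
    intro x
    rw [hg]
    exact Finset.sum_nonneg fun j _ => by split_ifs <;> positivity
  have hmono : ∀ k, ∀ x ∈ clos Ω, U k x ≤ 0 ∧ U (k + 1) x ≤ U k x := by
    intro k
    induction k with
    | zero =>
      refine fun x hx => ⟨le_rfl, nonpos_of_lap_sub_mul_nonneg hK₀ (fun y hy => ?_)
        (fun y hy => (hUb 1 y hy).le) x hx⟩
      refine le_of_le_of_eq ?_ (hU 0 y hy).symm
      simpa [F, U] using hg₀ y
    | succ k ih =>
      refine fun x hx => ⟨(ih x hx).2.trans (ih x hx).1, sub_nonpos.1 ?_⟩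
      refine nonpos_of_lap_sub_mul_nonneg hK₀ (v := fun y => U (k + 2) y - U (k + 1) y)
        (fun y hy => ?_) (fun y hy => by linarith [hUb (k + 1) y hy, hUb (k + 2) y hy]) x hx
      obtain ⟨h₀, h₁⟩ := ih y (Finset.mem_union_left _ hy)
      have e₁ := hU (k + 1) y hy
      have e₂ := hU k y hy
      simp only [F] at e₁ e₂
      have hlip := mul_le_mul_of_nonneg_left (exp_mul_exp_sub_one_sub_le_s9 h₁ h₀) hlam.le
      have hKlam : lam * (U k y - U (k + 1) y) ≤ K * (U k y - U (k + 1) y) :=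
        mul_le_mul_of_nonneg_right (by linarith) (by linarith)
      rw [lap_sub]
      linarith
  exact ⟨U, fun _ _ => rfl, hU, fun k => hUb (k + 1),
    fun k v w hv hvb hw hwb => eq_of_lap_sub_mul_eq hK₀
      (fun x hx => (hv x hx).trans (hw x hx).symm) (fun x hx => (hvb x hx).trans (hwb x hx).symm),
    fun k x hx => (hmono k x hx).2⟩
end

section
/- Nonpositivity of Chern–Simons subsolutions on a finite subset: let Ω ⊂ ℤⁿ be finite and λ > 0. If V : Ω̄ → ℝ satisfies ΔV(x) ≥ λ e^{V(x)}(e^{V(x)} − 1) for all x ∈ Ω and V ≤ 0 on δΩ, then V(x) ≤ 0 for all x ∈ Ω̄. -/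
open Real

/-- Nonpositivity of Chern–Simons subsolutions on a finite subset. -/
theorem stmt12 (n : ℕ) (hn : 2 ≤ n) (lam : ℝ) (hlam : 0 < lam)
    (Ω : Finset (Zn n)) (V : Zn n → ℝ)
    (h1 : ∀ x ∈ Ω, lam * (Real.exp (V x) * (Real.exp (V x) - 1)) ≤ lap V x)
    (h2 : ∀ x ∈ bdry Ω, V x ≤ 0) :
    ∀ x ∈ clos Ω, V x ≤ 0 := by
  intro x hx
  by_contra! hVx
  obtain ⟨m, hm, hmax⟩ := Finset.exists_max_image (clos Ω) V ⟨x, hx⟩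
  have hpos : 0 < V m := hVx.trans_le (hmax x hx)
  have hmΩ : m ∈ Ω := (Finset.mem_union.mp hm).resolve_right fun h => (h2 m h).not_gt hpos
  have hlap : lap V m ≤ 0 := Finset.sum_nonpos fun y hy => by
    refine sub_nonpos.mpr (hmax y ?_)
    by_cases hyΩ : y ∈ Ω
    · exact Finset.mem_union_left _ hyΩ
    · exact Finset.mem_union_right _
        (Finset.mem_sdiff.mpr ⟨Finset.mem_biUnion.mpr ⟨m, hmΩ, hy⟩, hyΩ⟩)
  have hrhs : 0 < lam * (Real.exp (V m) * (Real.exp (V m) - 1)) :=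
    mul_pos hlam (mul_pos (Real.exp_pos _) (sub_pos.mpr (Real.one_lt_exp_iff.mpr hpos)))
  exact (hrhs.trans_le (h1 m hmΩ)).not_ge hlap
end

section
/- Comparison with subsolutions: if V : Ω̄ → ℝ satisfies ΔV(x) ≥ λ e^{V(x)}(e^{V(x)} − 1) + g(x) for all x ∈ Ω and V ≤ 0 on δΩ, then V ≤ u_k on Ω̄ for every k ≥ 0, where (u_k) is the iteration sequence; in particular 0 = u₀ ≥ u₁ ≥ … ≥ u_k ≥ … ≥ V. -/
open Real

lemma nbrs_subset_clos {n : ℕ} {Ω : Finset (Zn n)} {x : Zn n} (hx : x ∈ Ω) :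
    nbrs x ⊆ clos Ω := by
  intro y hy
  by_cases hyΩ : y ∈ Ω
  · exact Finset.mem_union_left _ hyΩ
  · exact Finset.mem_union_right _
      (Finset.mem_sdiff.2 ⟨Finset.mem_biUnion.2 ⟨x, hx, hy⟩, hyΩ⟩)

/-- Maximum principle: a function which is nonpositive on the boundary and has positive
Laplacian wherever it is positive is nonpositive. -/
lemma nonpos_of_lap_pos {n : ℕ} {Ω : Finset (Zn n)} {w : Zn n → ℝ}
    (hbd : ∀ x ∈ bdry Ω, w x ≤ 0) (hlap : ∀ x ∈ Ω, 0 < w x → 0 < lap w x) :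
    ∀ x ∈ clos Ω, w x ≤ 0 := by
  intro x hx
  obtain ⟨z, hz, hmax⟩ := Finset.exists_max_image (clos Ω) w ⟨x, hx⟩
  refine (hmax x hx).trans ?_
  by_contra! hpos
  rcases Finset.mem_union.1 hz with hzΩ | hzb
  · refine (hlap z hzΩ hpos).not_ge (Finset.sum_nonpos fun y hy => ?_)
    linarith [hmax y (nbrs_subset_clos hzΩ hy)]
  · exact (hbd z hzb).not_gt hpos

lemma exp_mul_exp_sub_one_sub_antitone {lam K a b : ℝ} (hlam : 0 ≤ lam) (hK : lam ≤ K)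
    (hab : a ≤ b) (hb : b ≤ 0) :
    lam * (exp b * (exp b - 1)) - K * b ≤ lam * (exp a * (exp a - 1)) - K * a := by
  have hb1 : exp b ≤ 1 := exp_le_one_iff.2 hb
  have hle : exp a ≤ exp b := exp_le_exp.2 hab
  have hexp : exp b - exp a ≤ b - a := by
    have h : exp b * (a - b + 1) ≤ exp a := by
      calc exp b * (a - b + 1) ≤ exp b * exp (a - b) := by
            gcongr
            exact add_one_le_exp _
        _ = exp a := by rw [← exp_add]; congr 1; ring
    nlinarith
  have hquad : exp b * (exp b - 1) - exp a * (exp a - 1) ≤ b - a := by nlinarith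
  have hlip : lam * (exp b * (exp b - 1) - exp a * (exp a - 1)) ≤ K * (b - a) :=
    (mul_le_mul_of_nonneg_left hquad hlam).trans
      (mul_le_mul_of_nonneg_right hK (sub_nonneg.2 hab))
  linarith

/-- Comparison with subsolutions: a subsolution `V` lies below every iterate `u_k`. -/
theorem stmt13 (n : ℕ) (hn : 2 ≤ n) (lam : ℝ) (hlam : 0 < lam)
    (M : ℕ) (hM : 1 ≤ M) (nn : Fin M → ℕ) (hnn : ∀ j, 0 < nn j)
    (p : Fin M → Zn n) (hp : Function.Injective p)
    (g : Zn n → ℝ)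
    (hg : ∀ x, g x = ∑ j, if x = p j then 4 * Real.pi * (nn j : ℝ) else 0)
    (K : ℝ) (hK : 2 * lam < K)
    (Ω : Finset (Zn n)) (hΩp : ∀ j, p j ∈ Ω) (hconn : connFinset Ω)
    (U : ℕ → Zn n → ℝ)
    (hU0 : ∀ x ∈ clos Ω, U 0 x = 0)
    (hUeq : ∀ k : ℕ, ∀ x ∈ Ω,
      lap (U (k + 1)) x - K * U (k + 1) x
        = lam * (Real.exp (U k x) * (Real.exp (U k x) - 1)) + g x - K * U k x)
    (hUbd : ∀ k : ℕ, ∀ x ∈ bdry Ω, U (k + 1) x = 0)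
    (V : Zn n → ℝ)
    (hV1 : ∀ x ∈ Ω, lam * (Real.exp (V x) * (Real.exp (V x) - 1)) + g x ≤ lap V x)
    (hV2 : ∀ x ∈ bdry Ω, V x ≤ 0) :
    ∀ k : ℕ, ∀ x ∈ clos Ω, V x ≤ U k x := by
  have hg0 : ∀ x, 0 ≤ g x := fun x => by
    rw [hg]
    refine Finset.sum_nonneg fun j _ => ?_
    split_ifs <;> positivity
  have hK0 : 0 < K := by linarith
  have hlamK : lam ≤ K := by linarith
  have hU : ∀ k, ∀ x ∈ clos Ω, U k x ≤ 0 := by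
    intro k
    induction k with
    | zero => exact fun x hx => (hU0 x hx).le
    | succ k ih =>
      refine nonpos_of_lap_pos (fun x hx => (hUbd k x hx).le) fun x hx hpos => ?_
      have hf := exp_mul_exp_sub_one_sub_antitone hlam.le hlamK
        (ih x (Finset.mem_union_left _ hx)) le_rfl
      simp only [exp_zero, sub_self, mul_zero] at hf
      linarith [hUeq k x hx, hg0 x, mul_pos hK0 hpos]
  intro k
  induction k with
  | zero =>
    intro x hx
    rw [hU0 x hx]
    refine nonpos_of_lap_pos hV2 (fun x hx hpos => ?_) x hx
    have h1 : 0 < exp (V x) - 1 := sub_pos.2 (one_lt_exp_iff.2 hpos)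
    have h2 : 0 < lam * (exp (V x) * (exp (V x) - 1)) := by positivity
    linarith [hV1 x hx, hg0 x]
  | succ k ih =>
    intro x hx
    refine sub_nonpos.1 (nonpos_of_lap_pos (w := fun y => V y - U (k + 1) y)
      (fun y hy => ?_) (fun y hy hpos => ?_) x hx)
    · linarith [hV2 y hy, hUbd k y hy]
    · have hyc : y ∈ clos Ω := Finset.mem_union_left _ hy
      have hf := exp_mul_exp_sub_one_sub_antitone hlam.le hlamK (ih y hyc) (hU k y hyc)
      rw [lap_sub]
      linarith [hUeq k y hy, hV1 y hy, mul_pos hK0 hpos]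
end
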